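/- arXiv:1502.07481 — 8 statements merged into one kernel-verified Lean document; each statement's English description precedes it below -/
import Mathlib

section
/- Let l ≥ 2 and let M ∈ ℝ^{l×l} have zero row sums, i.e. M·1_l = 0. Define the reduced matrix M̂ ∈ ℝ^{(l−1)×(l−1)} by M̂_{pq} = M_{p+1,q+1} − M_{1,q+1} for 1 ≤ p,q ≤ l−1. Then 0 is an eigenvalue of M of algebraic multiplicity exactly one (i.e. 0 is a root of multiplicity exactly one of the characteristic polynomial of M) if and only if M̂ is invertible. -/
open Polynomial in
/-- The characteristic polynomial of a matrix with zero row sums is `X` times that of its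
reduced matrix. -/
theorem Matrix.charpoly_eq_X_mul_charpoly_reduced {R : Type*} [CommRing R] {n : ℕ}
    (M : Matrix (Fin (n + 1)) (Fin (n + 1)) R) (hrow : ∀ p, ∑ q, M p q = 0) :
    M.charpoly =
      X * (Matrix.of fun p q : Fin n => M p.succ q.succ - M 0 q.succ).charpoly := by
  have hsum (i : Fin (n + 1)) : ∑ j, M.charmatrix i j = X := by
    simp [charmatrix_apply, Finset.sum_sub_distrib, diagonal_apply, ← map_sum, hrow]
  let A := M.charmatrix.updateCol 0 fun _ => X
  let B : Matrix (Fin (n + 1)) (Fin (n + 1)) R[X] :=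
    of (Fin.cons (A 0) fun i => A i.succ - A 0)
  have hA : M.charmatrix.det = A.det := by
    have h := det_updateCol_sum M.charmatrix 0 fun _ => 1
    simp only [one_smul, hsum] at h
    exact h.symm
  have hAB : A.det = B.det := by
    refine det_eq_of_forall_row_eq_smul_add_const (Fin.cons 0 fun _ => 1) 0 (by simp) ?_
    intro i j
    cases i using Fin.cases <;> simp [B]
  have hminor : B.submatrix Fin.succ Fin.succ =
      (of fun p q : Fin n => M p.succ q.succ - M 0 q.succ).charmatrix := by
    ext1 p q
    simp [A, B, charmatrix_apply, diagonal_apply, Fin.succ_ne_zero, (Fin.succ_ne_zero _).symm]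
    ring
  rw [charpoly, hA, hAB, det_succ_column_zero, Fin.sum_univ_succ, Fin.succAbove_zero, hminor,
    charpoly]
  simp [A, B]

/-- `0` is an eigenvalue of a zero-row-sum matrix `M ∈ ℝ^{l×l}` of algebraic multiplicity
exactly one if and only if the reduced matrix `M̂`, with entries
`M̂ p q = M (p+1) (q+1) - M 0 (q+1)`, is invertible. -/
theorem zero_simple_eigenvalue_iff_reduced_invertible
    (l : ℕ) (hl : 2 ≤ l) (M : Matrix (Fin l) (Fin l) ℝ)
    (hrow : ∀ p : Fin l, ∑ q : Fin l, M p q = 0) :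
    Polynomial.rootMultiplicity (0 : ℝ) M.charpoly = 1 ↔
      IsUnit (Matrix.of fun p q : Fin (l - 1) =>
        M ⟨p.1 + 1, by have := p.2; omega⟩ ⟨q.1 + 1, by have := q.2; omega⟩
          - M ⟨0, by omega⟩ ⟨q.1 + 1, by have := q.2; omega⟩) := by
  obtain ⟨n, rfl⟩ : ∃ n, l = n + 1 := ⟨l - 1, by omega⟩
  change _ ↔ IsUnit (Matrix.of fun p q : Fin n => M p.succ q.succ - M 0 q.succ)
  rw [M.charpoly_eq_X_mul_charpoly_reduced hrow]
  set N : Matrix (Fin n) (Fin n) ℝ := Matrix.of fun p q => M p.succ q.succ - M 0 q.succ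
  have hX : Polynomial.rootMultiplicity (0 : ℝ) Polynomial.X = 1 := by
    simpa using Polynomial.rootMultiplicity_X_sub_C_self (x := (0 : ℝ))
  have hN : N.charpoly ≠ 0 := N.charpoly_monic.ne_zero
  rw [Polynomial.rootMultiplicity_mul (mul_ne_zero Polynomial.X_ne_zero hN), hX,
    Nat.add_eq_left, Polynomial.rootMultiplicity_eq_zero_iff, Matrix.isUnit_iff_isUnit_det,
    isUnit_iff_ne_zero, Polynomial.IsRoot, Matrix.eval_charpoly]
  simp [hN, Matrix.det_neg]
end

section
/- Let l_1,…,l_N be positive integers with L = Σ_{i=1}^N l_i, σ_1 = 0 and σ_i = l_1+…+l_{i−1}, and let 𝓛 ∈ ℝ^{L×L} be partitioned into blocks L_{ij} ∈ ℝ^{l_i×l_j} (rows σ_i+1,…,σ_i+l_i and columns σ_j+1,…,σ_j+l_j), every block having zero row sums: L_{ij}·1_{l_j} = 0. For positive reals c_1,…,c_N let 𝓛_c be the L×L matrix with diagonal blocks c_i L_{ii} and off-diagonal blocks L_{ij}, and let L̂_c be the (L−N)×(L−N) matrix with diagonal blocks c_i L̂_{ii} and off-diagonal blocks L̂_{ij},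 where (L̂_{ij})_{pq} = (L_{ij})_{p+1,q+1} − (L_{ij})_{1,q+1}. Then the characteristic polynomial of 𝓛_c equals X^N times the characteristic polynomial of L̂_c. -/
open Polynomial

/-- If every block of `M` has zero row sums, then subtracting the first row of each block row and
deleting the first row and column of each block removes a factor `X` per block from the
characteristic polynomial. -/
theorem Matrix.charpoly_eq_X_pow_mul_charpoly_of_block_row_sum_eq_zero {R ι : Type*} [CommRing R]
    [Fintype ι] [DecidableEq ι] (k : ι → ℕ)
    (M : Matrix ((i : ι) × Fin (k i + 1)) ((i : ι) × Fin (k i + 1)) R)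
    (hM : ∀ a j, ∑ q, M a ⟨j, q⟩ = 0) :
    M.charpoly = X ^ Fintype.card ι *
      (Matrix.of fun b b' : (i : ι) × Fin (k i) =>
        M ⟨b.1, b.2.succ⟩ ⟨b'.1, b'.2.succ⟩ - M ⟨b.1, 0⟩ ⟨b'.1, b'.2.succ⟩).charpoly := by
  let A : Matrix ((i : ι) × Fin (k i + 1)) ((i : ι) × Fin (k i)) R :=
    Matrix.of fun a b => M a ⟨b.1, b.2.succ⟩
  let B : Matrix ((i : ι) × Fin (k i)) ((i : ι) × Fin (k i + 1)) R :=
    Matrix.of fun b a => (if (⟨b.1, b.2.succ⟩ : (i : ι) × Fin (k i + 1)) = a then 1 else 0) -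
      (if (⟨b.1, 0⟩ : (i : ι) × Fin (k i + 1)) = a then 1 else 0)
  have hAB : A * B = M := by
    ext a ⟨j, q⟩
    have hblock : ∀ i ≠ j, ∑ p : Fin (k i), A a ⟨i, p⟩ * B ⟨i, p⟩ ⟨j, q⟩ = 0 := fun i hi =>
      Finset.sum_eq_zero fun p _ => by simp [B, hi]
    rw [Matrix.mul_apply, Fintype.sum_sigma, Fintype.sum_eq_single j hblock]
    induction q using Fin.cases with
    | zero =>
      have h := hM a j
      rw [Fin.sum_univ_succ] at h
      simpa [A, B] using (eq_neg_of_add_eq_zero_left h).symm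
    | succ q => simp [A, B, (Fin.succ_ne_zero _).symm]
  have hBA : B * A = Matrix.of fun b b' : (i : ι) × Fin (k i) =>
      M ⟨b.1, b.2.succ⟩ ⟨b'.1, b'.2.succ⟩ - M ⟨b.1, 0⟩ ⟨b'.1, b'.2.succ⟩ := by
    ext b b'
    simp [A, B, Matrix.mul_apply, sub_mul, Finset.sum_sub_distrib]
  have hcomm := Matrix.charpoly_mul_comm' A B
  rw [hAB, hBA] at hcomm
  have hcard : Fintype.card ((i : ι) × Fin (k i + 1)) =
      Fintype.card ((i : ι) × Fin (k i)) + Fintype.card ι := by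
    simp [Finset.sum_add_distrib]
  rw [hcard, pow_add, mul_assoc] at hcomm
  exact (Polynomial.isRegular_X_pow _).left hcomm

/-- The weighted graph Laplacian `𝓛_c` (diagonal blocks `c_i L_{ii}`, off-diagonal blocks
`L_{ij}`, every block having zero row sums) has characteristic polynomial equal to
`X ^ N` times that of the reduced matrix `L̂_c` (diagonal blocks `c_i L̂_{ii}`,
off-diagonal blocks `L̂_{ij}`, where `(L̂_{ij}) p q = (L_{ij}) (p+1) (q+1) - (L_{ij}) 0 (q+1)`). -/
theorem charpoly_weighted_laplacian_eq_X_pow_mul_charpoly_reduced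
    (N : ℕ) (l : Fin N → ℕ) (hl : ∀ i, 1 ≤ l i)
    (𝓛 : Matrix ((i : Fin N) × Fin (l i)) ((i : Fin N) × Fin (l i)) ℝ)
    (hrow : ∀ (i j : Fin N) (p : Fin (l i)), ∑ q : Fin (l j), 𝓛 ⟨i, p⟩ ⟨j, q⟩ = 0)
    (c : Fin N → ℝ) (hc : ∀ i, 0 < c i) :
    (Matrix.of fun b b' : (i : Fin N) × Fin (l i) =>
        (if b.1 = b'.1 then c b.1 else 1) * 𝓛 b b').charpoly
      = X ^ N *
        (Matrix.of fun b b' : (i : Fin N) × Fin (l i - 1) =>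
          (if b.1 = b'.1 then c b.1 else 1) *
            (𝓛 ⟨b.1, ⟨b.2.1 + 1, by have := b.2.2; omega⟩⟩
                ⟨b'.1, ⟨b'.2.1 + 1, by have := b'.2.2; omega⟩⟩
             - 𝓛 ⟨b.1, ⟨0, by have := b.2.2; omega⟩⟩
                ⟨b'.1, ⟨b'.2.1 + 1, by have := b'.2.2; omega⟩⟩)).charpoly := by
  obtain ⟨k, rfl⟩ : ∃ k : Fin N → ℕ, l = fun i => k i + 1 :=
    ⟨fun i => l i - 1, funext fun i => (Nat.sub_add_cancel (hl i)).symm⟩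
  have h := Matrix.charpoly_eq_X_pow_mul_charpoly_of_block_row_sum_eq_zero k
    (Matrix.of fun b b' => (if b.1 = b'.1 then c b.1 else 1) * 𝓛 b b')
    (fun a j => (Finset.mul_sum Finset.univ (fun q => 𝓛 a ⟨j, q⟩)
      (if a.1 = j then c a.1 else 1)).symm.trans (mul_eq_zero_of_right _ (hrow a.1 j a.2)))
  simp only [Matrix.of_apply, ← mul_sub, Fintype.card_fin] at h
  exact h
end

section
/- Let l_1,…,l_N be positive integers with L = Σ_{i=1}^N l_i, and let 𝓛 ∈ ℝ^{L×L} be partitioned into blocks L_{ij} ∈ ℝ^{l_i×l_j}, every block having zero row sums. For positive reals c_1,…,c_N form 𝓛_c and L̂_c as above. Then 0 is an eigenvalue of 𝓛_c of algebraic multiplicity exactly N if and only if L̂_c is invertible. Moreover, for each i, the diagonal block L_{ii} has 0 as an eigenvalue of algebraic multiplicity exactly one if and only if L̂_{ii} is invertible. -/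
open Polynomial

namespace Matrix

variable {R m n α : Type*} [CommRing R] [Fintype m] [Fintype n] [Fintype α]
  [DecidableEq m] [DecidableEq n] [DecidableEq α]

/-- If the columns of `[1; E]` lie in the kernel of a block matrix, its characteristic
polynomial is a power of `X` times that of `D - E * B`. -/
theorem charpoly_fromBlocks_of_mul_eq_zero (A : Matrix m m R) (B : Matrix m n R)
    (C : Matrix n m R) (D : Matrix n n R) (E : Matrix n m R)
    (hA : A + B * E = 0) (hC : C + D * E = 0) :
    (fromBlocks A B C D).charpoly = X ^ Fintype.card m * (D - E * B).charpoly := by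
  let P : (Matrix (m ⊕ n) (m ⊕ n) R)ˣ :=
    { val := fromBlocks 1 0 E 1
      inv := fromBlocks 1 0 (-E) 1
      val_inv := by simp [fromBlocks_multiply, fromBlocks_one]
      inv_val := by simp [fromBlocks_multiply, fromBlocks_one] }
  have hP : P⁻¹.val * fromBlocks A B C D * P.val = fromBlocks 0 B 0 (D - E * B) := by
    change fromBlocks 1 0 (-E) 1 * _ * fromBlocks 1 0 E 1 = _
    rw [Matrix.mul_assoc, fromBlocks_multiply, fromBlocks_multiply]
    simp [hA, hC, sub_eq_neg_add]
  rw [← charpoly_units_conj' P, ← coe_units_inv, hP, charpoly_fromBlocks_zero₂₁, charpoly_zero]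

/-- Let the index set of `M` be split into classes, each with a representative indexed by `m`, the
class of the remaining index `q : n` being `r q`. If `M` has zero row sums over every class, then
its characteristic polynomial is a power of `X` times that of the reduced matrix. -/
theorem charpoly_of_class_row_sums_eq_zero (e : m ⊕ n ≃ α) (r : n → m) (M : Matrix α α R)
    (h : ∀ a j, M a (e (.inl j)) + ∑ q, (if r q = j then M a (e (.inr q)) else 0) = 0) :
    M.charpoly = X ^ Fintype.card m * (of fun p q : n =>
      M (e (.inr p)) (e (.inr q)) - M (e (.inl (r p))) (e (.inr q))).charpoly := by
  rw [← charpoly_reindex e.symm M, ← fromBlocks_toBlocks (reindex e.symm e.symm M),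
    charpoly_fromBlocks_of_mul_eq_zero _ _ _ _ (of fun q j => if r q = j then 1 else 0)]
  · congr 2
    ext p q
    simp [toBlocks₂₂, toBlocks₁₂, mul_apply]
  · ext i j
    simpa [toBlocks₁₁, toBlocks₁₂, mul_apply] using h (e (.inl i)) j
  · ext i j
    simpa [toBlocks₂₁, toBlocks₂₂, mul_apply] using h (e (.inr i)) j

theorem rootMultiplicity_zero_X_pow_mul_charpoly_eq_iff {K : Type*} [Field K]
    (k : ℕ) (M : Matrix n n K) :
    rootMultiplicity 0 (X ^ k * M.charpoly) = k ↔ IsUnit M := by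
  have hX : rootMultiplicity (0 : K) (X ^ k) = k := by
    simpa using rootMultiplicity_X_sub_C_pow (0 : K) k
  have hne : (X ^ k * M.charpoly) ≠ 0 :=
    mul_ne_zero (pow_ne_zero _ X_ne_zero) M.charpoly_monic.ne_zero
  rw [rootMultiplicity_mul hne, hX, Nat.add_eq_left, rootMultiplicity_eq_zero_iff,
    isUnit_iff_isUnit_det, isUnit_iff_ne_zero, det_eq_sign_charpoly_coeff, IsRoot.def,
    ← coeff_zero_eq_eval_zero]
  simp [M.charpoly_monic.ne_zero]

end Matrix

/-- Splitting off the first index of every block. -/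
def sumSigmaFinEquiv {ι : Type*} (k : ι → ℕ) :
    (ι ⊕ (i : ι) × Fin (k i)) ≃ (i : ι) × Fin (k i + 1) where
  toFun := Sum.elim (fun i => ⟨i, 0⟩) fun b => ⟨b.1, b.2.succ⟩
  invFun b := Fin.cases (.inl b.1) (fun p => .inr ⟨b.1, p⟩) b.2
  left_inv := by rintro (i | ⟨i, p⟩) <;> rfl
  right_inv := by rintro ⟨i, p⟩; cases p using Fin.cases <;> rfl

/-- Splitting off the first index. -/
def unitSumFinEquiv (k : ℕ) : Unit ⊕ Fin k ≃ Fin (k + 1) where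
  toFun := Sum.elim (fun _ => 0) Fin.succ
  invFun p := Fin.cases (.inl ()) .inr p
  left_inv := by rintro (i | p) <;> rfl
  right_inv p := by cases p using Fin.cases <;> rfl

/-- `0` is an eigenvalue of the weighted graph Laplacian `𝓛_c` of algebraic multiplicity
exactly `N` if and only if the reduced matrix `L̂_c` is invertible; moreover, each diagonal
block `L_{ii}` has `0` as an eigenvalue of algebraic multiplicity exactly one if and only if
the reduced block `L̂_{ii}` is invertible. -/
theorem laplacian_zero_multiplicity_iff_reduced_invertible
    (N : ℕ) (l : Fin N → ℕ) (hl : ∀ i, 1 ≤ l i)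
    (𝓛 : Matrix ((i : Fin N) × Fin (l i)) ((i : Fin N) × Fin (l i)) ℝ)
    (hrow : ∀ (i j : Fin N) (p : Fin (l i)), ∑ q : Fin (l j), 𝓛 ⟨i, p⟩ ⟨j, q⟩ = 0)
    (c : Fin N → ℝ) (hc : ∀ i, 0 < c i) :
    (Polynomial.rootMultiplicity (0 : ℝ)
        (Matrix.of fun b b' : (i : Fin N) × Fin (l i) =>
          (if b.1 = b'.1 then c b.1 else 1) * 𝓛 b b').charpoly = N ↔
      IsUnit (Matrix.of fun b b' : (i : Fin N) × Fin (l i - 1) =>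
        (if b.1 = b'.1 then c b.1 else 1) *
          (𝓛 ⟨b.1, ⟨b.2.1 + 1, by have := b.2.2; omega⟩⟩
              ⟨b'.1, ⟨b'.2.1 + 1, by have := b'.2.2; omega⟩⟩
           - 𝓛 ⟨b.1, ⟨0, by have := b.2.2; omega⟩⟩
              ⟨b'.1, ⟨b'.2.1 + 1, by have := b'.2.2; omega⟩⟩)))
    ∧ ∀ i : Fin N,
        (Polynomial.rootMultiplicity (0 : ℝ)
            (Matrix.of fun p q : Fin (l i) => 𝓛 ⟨i, p⟩ ⟨i, q⟩).charpoly = 1 ↔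
          IsUnit (Matrix.of fun p q : Fin (l i - 1) =>
            𝓛 ⟨i, ⟨p.1 + 1, by have := p.2; omega⟩⟩ ⟨i, ⟨q.1 + 1, by have := q.2; omega⟩⟩
              - 𝓛 ⟨i, ⟨0, by have := p.2; omega⟩⟩ ⟨i, ⟨q.1 + 1, by have := q.2; omega⟩⟩)) := by
  obtain ⟨k, rfl⟩ : ∃ k : Fin N → ℕ, l = fun i => k i + 1 :=
    ⟨fun i => l i - 1, funext fun i => (Nat.sub_add_cancel (hl i)).symm⟩
  refine ⟨?_, fun i => ?_⟩
  · rw [Matrix.charpoly_of_class_row_sums_eq_zero (sumSigmaFinEquiv k) Sigma.fst,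
      Fintype.card_fin, Matrix.rootMultiplicity_zero_X_pow_mul_charpoly_eq_iff]
    · refine iff_of_eq (congrArg IsUnit ?_)
      ext b b'
      exact (mul_sub _ _ _).symm
    · rintro ⟨i, p⟩ j
      have h := congrArg ((if i = j then c i else 1) * ·) (hrow i j p)
      simp only [Fin.sum_univ_succ, mul_add, Finset.mul_sum, mul_zero] at h
      rw [Fintype.sum_sigma, Finset.sum_eq_single j]
      · simpa [sumSigmaFinEquiv] using h
      · intro j' _ hj
        simp [hj]
      · simp
  · rw [Matrix.charpoly_of_class_row_sums_eq_zero (unitSumFinEquiv (k i)) (fun _ => ())]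
    · exact Matrix.rootMultiplicity_zero_X_pow_mul_charpoly_eq_iff 1 _
    · intro p j
      simpa [unitSumFinEquiv, Fin.sum_univ_succ] using hrow i i p
end

section
/- Consider the multi-agent system of N clusters with the dynamic coupling law, where for each i the gain is K_i = −B_iᵀP_i with P_i symmetric positive definite solving P_iA_i + A_iᵀP_i − P_iB_iB_iᵀP_i = −I, and every block L_{ij} of the graph Laplacian has zero row sums. If the matrix Â − c L̂_c ⊗ I_n is Hurwitz, then for every choice of initial conditions x_l(0), η_l(0) (l = 1,…,L), the closed-loop solutions satisfy: (i) x_l(t) − x_k(t) → 0 as t → ∞ for all l,k belonging to the same cluster, and (ii) η_l(t) → 0 as t → ∞ for every l. -/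
open Matrix Filter Topology

/-- A real square matrix is Hurwitz if every complex eigenvalue has negative real part. -/
noncomputable def IsHurwitz {m : Type*} [Fintype m] [DecidableEq m] (M : Matrix m m ℝ) : Prop :=
  ∀ μ ∈ spectrum ℂ (M.map Complex.ofReal), μ.re < 0

/-- The reduced matrix `L̂` of a block-partitioned matrix `b` on the index set
`Σ i, Fin (l i)` : the `(i,j)` block has entries `(L_{ij}) (p+1) (q+1) - (L_{ij}) 0 (q+1)`. -/
noncomputable def reducedLap (N : ℕ) (l : Fin N → ℕ)
    (b : ((i : Fin N) × Fin (l i)) → ((i : Fin N) × Fin (l i)) → ℝ) :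
    Matrix ((i : Fin N) × Fin (l i - 1)) ((i : Fin N) × Fin (l i - 1)) ℝ :=
  Matrix.of fun p q =>
    b ⟨p.1, ⟨p.2.1 + 1, by have := p.2.2; omega⟩⟩ ⟨q.1, ⟨q.2.1 + 1, by have := q.2.2; omega⟩⟩
      - b ⟨p.1, ⟨0, by have := p.2.2; omega⟩⟩ ⟨q.1, ⟨q.2.1 + 1, by have := q.2.2; omega⟩⟩

/-- The weighted reduced matrix `L̂_c`: diagonal blocks `c_i L̂_{ii}`, off-diagonal
blocks `L̂_{ij}`. -/
noncomputable def reducedLapWeighted (N : ℕ) (l : Fin N → ℕ) (ci : Fin N → ℝ)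
    (b : ((i : Fin N) × Fin (l i)) → ((i : Fin N) × Fin (l i)) → ℝ) :
    Matrix ((i : Fin N) × Fin (l i - 1)) ((i : Fin N) × Fin (l i - 1)) ℝ :=
  Matrix.of fun p q =>
    (if p.1 = q.1 then ci p.1 else 1) * reducedLap N l b p q

/-- `Â = blockdiag {I_{l_1 - 1} ⊗ A_1, …, I_{l_N - 1} ⊗ A_N}`. -/
noncomputable def hatA (n N : ℕ) (l : Fin N → ℕ) (A : Fin N → Matrix (Fin n) (Fin n) ℝ) :
    Matrix (((i : Fin N) × Fin (l i - 1)) × Fin n)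
      (((i : Fin N) × Fin (l i - 1)) × Fin n) ℝ :=
  Matrix.of fun p q => if p.1 = q.1 then A p.1.1 p.2 q.2 else 0

/-- The matrix `Â - c L̂_c ⊗ I_n`. -/
noncomputable def clusterMatrix (n N : ℕ) (l : Fin N → ℕ) (c : ℝ) (ci : Fin N → ℝ)
    (A : Fin N → Matrix (Fin n) (Fin n) ℝ)
    (b : ((i : Fin N) × Fin (l i)) → ((i : Fin N) × Fin (l i)) → ℝ) :
    Matrix (((i : Fin N) × Fin (l i - 1)) × Fin n)
      (((i : Fin N) × Fin (l i - 1)) × Fin n) ℝ :=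
  hatA n N l A -
    c • Matrix.kroneckerMap (· * ·) (reducedLapWeighted N l ci b)
      (1 : Matrix (Fin n) (Fin n) ℝ)

/-- A nonnegative function with `V' ≤ -α V + g`, where `α > 0` and `g → 0`, tends to zero. -/
theorem tendsto_zero_of_hasDerivAt_le {V V' g : ℝ → ℝ} {α : ℝ} (hα : 0 < α)
    (hV : ∀ t, HasDerivAt V (V' t) t) (hle : ∀ t, V' t ≤ -α * V t + g t)
    (hnn : ∀ t, 0 ≤ V t) (hg : Tendsto g atTop (𝓝 0)) : Tendsto V atTop (𝓝 0) := by
  rw [tendsto_order]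
  refine ⟨fun a ha => Eventually.of_forall fun t => ha.trans_le (hnn t), fun ε hε => ?_⟩
  obtain ⟨T, hT⟩ := eventually_atTop.1 (hg.eventually_lt_const (by positivity : 0 < α * (ε / 2)))
  have hd : ∀ t, HasDerivAt (fun t => (V t - ε / 2) * Real.exp (α * t))
      (V' t * Real.exp (α * t) + (V t - ε / 2) * (Real.exp (α * t) * (α * 1))) t := fun t =>
    ((hV t).sub_const _).mul (((hasDerivAt_id t).const_mul α).exp)
  have hanti : AntitoneOn (fun t => (V t - ε / 2) * Real.exp (α * t)) (Set.Ici T) := by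
    refine antitoneOn_of_deriv_nonpos (convex_Ici T)
      (fun t _ => (hd t).continuousAt.continuousWithinAt)
      (fun t _ => (hd t).differentiableAt.differentiableWithinAt) fun t ht => ?_
    rw [interior_Ici] at ht
    rw [(hd t).deriv]
    have h1 := hle t
    have h2 := hT t (le_of_lt ht)
    have h3 : V' t + (V t - ε / 2) * α ≤ 0 := by nlinarith
    nlinarith [Real.exp_pos (α * t)]
  have hexp : Tendsto (fun t => (V T - ε / 2) * Real.exp (α * T) * Real.exp (-(α * t))) atTop
      (𝓝 0) := by
    simpa using (Real.tendsto_exp_neg_atTop_nhds_zero.comp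
      (tendsto_id.const_mul_atTop hα)).const_mul ((V T - ε / 2) * Real.exp (α * T))
  filter_upwards [eventually_ge_atTop T, hexp.eventually_lt_const (half_pos hε)] with t ht hlt
  have h1 : (V t - ε / 2) * Real.exp (α * t) ≤ (V T - ε / 2) * Real.exp (α * T) :=
    hanti Set.self_mem_Ici ht ht
  have h2 := mul_le_mul_of_nonneg_right h1 (Real.exp_pos (-(α * t))).le
  rw [mul_assoc, ← Real.exp_add, add_neg_cancel, Real.exp_zero] at h2
  linarith

theorem tendsto_zero_of_hasDerivAt_mul_add {u w : ℝ → ℂ} {μ : ℂ} (hμ : μ.re < 0)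
    (hu : ∀ t, HasDerivAt u (μ * u t + w t) t) (hw : Tendsto w atTop (𝓝 0)) :
    Tendsto u atTop (𝓝 0) := by
  have hre : ∀ t, HasDerivAt (fun s => (u s).re) (μ * u t + w t).re t := fun t =>
    Complex.reCLM.hasFDerivAt.comp_hasDerivAt t (hu t)
  have him : ∀ t, HasDerivAt (fun s => (u s).im) (μ * u t + w t).im t := fun t =>
    Complex.imCLM.hasFDerivAt.comp_hasDerivAt t (hu t)
  have hg : Tendsto (fun t => ‖w t‖ ^ 2 / (-μ.re)) atTop (𝓝 0) := by
    simpa using (hw.norm.pow 2).div_const (-μ.re)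
  have hV : Tendsto (fun t => (u t).re ^ 2 + (u t).im ^ 2) atTop (𝓝 0) := by
    refine tendsto_zero_of_hasDerivAt_le (neg_pos.2 hμ)
      (fun t => ((hre t).pow 2).add ((him t).pow 2)) (fun t => ?_) (fun t => by positivity) hg
    rw [Complex.sq_norm, Complex.normSq_apply]
    have h : (-μ.re) * (((w t).re * (w t).re + (w t).im * (w t).im) / (-μ.re)) =
        (w t).re * (w t).re + (w t).im * (w t).im := mul_div_cancel₀ _ (neg_pos.2 hμ).ne'
    generalize ((w t).re * (w t).re + (w t).im * (w t).im) / (-μ.re) = G at *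
    simp only [Complex.add_re, Complex.mul_re, Complex.add_im, Complex.mul_im]
    refine le_of_mul_le_mul_left ?_ (neg_pos.2 hμ)
    push_cast
    nlinarith [sq_nonneg (μ.re * (u t).re + (w t).re), sq_nonneg (μ.re * (u t).im + (w t).im)]
  rw [tendsto_zero_iff_norm_tendsto_zero]
  have h := hV.sqrt
  rw [Real.sqrt_zero] at h
  refine h.congr fun t => ?_
  rw [Complex.norm_def, Complex.normSq_apply, pow_two, pow_two]

theorem HasDerivAt.const_mulVec {ι κ 𝕜 : Type*} [Fintype ι] [Fintype κ] [RCLike 𝕜]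
    (M : Matrix κ ι 𝕜) {y : ℝ → ι → 𝕜} {y' : ι → 𝕜} {t : ℝ} (hy : HasDerivAt y y' t) :
    HasDerivAt (fun s => M *ᵥ y s) (M *ᵥ y') t := by
  rw [hasDerivAt_pi] at hy ⊢
  intro i
  simp only [Matrix.mulVec, dotProduct]
  exact HasDerivAt.fun_sum fun j _ => (hy j).const_mul (M i j)

theorem tendsto_const_mulVec_zero {ι 𝕜 : Type*} [Fintype ι] [RCLike 𝕜] (M : Matrix ι ι 𝕜)
    {w : ℝ → ι → 𝕜} (hw : Tendsto w atTop (𝓝 0)) : Tendsto (fun t => M *ᵥ w t) atTop (𝓝 0) := by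
  have h : Continuous fun v : ι → 𝕜 => M *ᵥ v := continuous_const.matrix_mulVec continuous_id
  simpa [Function.comp_def] using (h.tendsto 0).comp hw

open Polynomial in
/-- If `∏ (M - μ)` over finitely many `μ` in the open left half-plane sends a solution of
`y' = M y + w`, `w → 0`, to a vanishing function, then the solution itself vanishes at infinity. -/
theorem tendsto_zero_of_tendsto_aeval_prod {ι : Type*} [Fintype ι] [DecidableEq ι]
    {M : Matrix ι ι ℂ} {y w : ℝ → ι → ℂ}
    (hy : ∀ t, HasDerivAt y (M *ᵥ y t + w t) t) (hw : Tendsto w atTop (𝓝 0))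
    (s : Multiset ℂ) (hs : ∀ μ ∈ s, μ.re < 0)
    (h : Tendsto (fun t => aeval M (s.map fun μ => X - C μ).prod *ᵥ y t) atTop (𝓝 0)) :
    Tendsto y atTop (𝓝 0) := by
  induction s using Multiset.induction_on with
  | empty => simpa using h
  | cons μ s ih =>
    refine ih (fun ν hν => hs ν (Multiset.mem_cons_of_mem hν)) ?_
    set Q := aeval M (s.map fun μ => X - C μ).prod with hQ
    have hcomm : Q * M = M * Q := by
      have := Polynomial.aeval_mul M (p := (s.map fun μ => X - C μ).prod) (q := X)
      rw [mul_comm, map_mul, aeval_X] at this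
      exact this.symm
    have hfac : ∀ v, aeval M ((μ ::ₘ s).map fun μ => X - C μ).prod *ᵥ v =
        M *ᵥ (Q *ᵥ v) - μ • (Q *ᵥ v) := fun v => by
      rw [Multiset.map_cons, Multiset.prod_cons, map_mul, ← hQ, map_sub, aeval_X, aeval_C,
        sub_mul, Matrix.sub_mulVec, Matrix.mulVec_mulVec, Algebra.algebraMap_eq_smul_one,
        smul_mul_assoc, one_mul, Matrix.smul_mulVec]
    have hder : ∀ t, HasDerivAt (fun t => Q *ᵥ y t)
        (μ • (Q *ᵥ y t) + ((M *ᵥ (Q *ᵥ y t) - μ • (Q *ᵥ y t)) + Q *ᵥ w t)) t := fun t => by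
      convert (hy t).const_mulVec Q using 1
      rw [Matrix.mulVec_add, Matrix.mulVec_mulVec _ Q M, hcomm, ← Matrix.mulVec_mulVec]
      abel
    simp only [hfac] at h
    have hin := h.add (tendsto_const_mulVec_zero Q hw)
    rw [add_zero] at hin
    rw [tendsto_pi_nhds] at hin ⊢
    exact fun i => tendsto_zero_of_hasDerivAt_mul_add (hs μ (Multiset.mem_cons_self μ s))
      (fun t => hasDerivAt_pi.1 (hder t) i) (hin i)

/-- A Hurwitz linear system driven by a vanishing input has vanishing solutions. -/
theorem IsHurwitz.tendsto_zero {ι : Type*} [Fintype ι] [DecidableEq ι] {M : Matrix ι ι ℝ}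
    (hM : IsHurwitz M) {y w : ℝ → ι → ℝ}
    (hy : ∀ t, HasDerivAt y (M *ᵥ y t + w t) t) (hw : Tendsto w atTop (𝓝 0)) :
    Tendsto y atTop (𝓝 0) := by
  have hre : ∀ (v : ι → ℝ) (i : ι),
      (M.map Complex.ofReal *ᵥ fun j => (v j : ℂ)) i = ((M *ᵥ v) i : ℝ) := fun v i => by
    simp [Matrix.mulVec, dotProduct]
  have hY : Tendsto (fun t i => (y t i : ℂ)) atTop (𝓝 0) := by
    refine tendsto_zero_of_tendsto_aeval_prod (M := M.map Complex.ofReal)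
      (w := fun t i => (w t i : ℂ)) (fun t => hasDerivAt_pi.2 fun i => ?_)
      (tendsto_pi_nhds.2 fun i => ?_) (M.map Complex.ofReal).charpoly.roots
      (fun μ hμ => hM μ ?_) ?_
    · refine (hasDerivAt_pi.1 (hy t) i).ofReal_comp.congr_deriv (Eq.symm ?_)
      exact (congrArg (· + (w t i : ℂ)) (hre (y t) i)).trans (Complex.ofReal_add _ _).symm
    · simpa [Function.comp_def] using
        (Complex.continuous_ofReal.tendsto 0).comp (tendsto_pi_nhds.1 hw i)
    · exact Matrix.mem_spectrum_iff_isRoot_charpoly.2 (Polynomial.isRoot_of_mem_roots hμ)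
    · rw [← (IsAlgClosed.splits _).eq_prod_roots_of_monic (Matrix.charpoly_monic _),
        Matrix.aeval_self_charpoly]
      simp
  rw [tendsto_pi_nhds] at hY ⊢
  intro i
  simpa [Function.comp_def] using (Complex.continuous_re.tendsto 0).comp (hY i)

theorem isHurwitz_of_lyapunov {ι : Type*} [Fintype ι] [DecidableEq ι] {M P : Matrix ι ι ℝ}
    (hP : P.PosDef) (h : ∀ v, v ≠ 0 → v ⬝ᵥ (P *ᵥ (M *ᵥ v)) < 0) : IsHurwitz M := by
  intro μ hμ
  rw [← Matrix.spectrum_toLin', ← Module.End.hasEigenvalue_iff_mem_spectrum] at hμ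
  obtain ⟨v, hv⟩ := hμ.exists_hasEigenvector
  have heq : M.map Complex.ofReal *ᵥ v = μ • v := by simpa using hv.apply_eq_smul
  set r : ι → ℝ := fun i => (v i).re with hr
  set s : ι → ℝ := fun i => (v i).im with hs
  have hMr : M *ᵥ r = μ.re • r - μ.im • s := by
    ext i
    simpa [Matrix.mulVec, dotProduct] using congrArg Complex.re (congrFun heq i)
  have hMs : M *ᵥ s = μ.re • s + μ.im • r := by
    ext i
    simpa [Matrix.mulVec, dotProduct] using congrArg Complex.im (congrFun heq i)
  have hsymm : r ⬝ᵥ (P *ᵥ s) = s ⬝ᵥ (P *ᵥ r) := by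
    have hT : Pᵀ = P := by simpa using hP.isHermitian.eq
    rw [Matrix.dotProduct_mulVec, ← Matrix.mulVec_transpose, hT, dotProduct_comm]
  have hle : ∀ u, u ⬝ᵥ (P *ᵥ (M *ᵥ u)) ≤ 0 := fun u => by
    rcases eq_or_ne u 0 with rfl | hu
    · simp
    · exact (h u hu).le
  have hnn : ∀ u, 0 ≤ u ⬝ᵥ (P *ᵥ u) := fun u => by
    simpa using hP.posSemidef.dotProduct_mulVec_nonneg u
  have hneg : r ⬝ᵥ (P *ᵥ (M *ᵥ r)) + s ⬝ᵥ (P *ᵥ (M *ᵥ s)) < 0 := by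
    by_cases hr0 : r = 0
    · have hs0 : s ≠ 0 := fun hs0 => hv.2 <| funext fun i =>
        Complex.ext (congrFun hr0 i) (congrFun hs0 i)
      linarith [hle r, h s hs0]
    · linarith [hle s, h r hr0]
  have hsum : r ⬝ᵥ (P *ᵥ (M *ᵥ r)) + s ⬝ᵥ (P *ᵥ (M *ᵥ s)) =
      μ.re * (r ⬝ᵥ (P *ᵥ r) + s ⬝ᵥ (P *ᵥ s)) := by
    rw [hMr, hMs]
    simp only [Matrix.mulVec_sub, Matrix.mulVec_add, Matrix.mulVec_smul, dotProduct_sub,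
      dotProduct_add, dotProduct_smul, smul_eq_mul, hsymm]
    ring
  rw [hsum] at hneg
  by_contra! hcon
  exact absurd hneg (not_lt.2 (mul_nonneg hcon (add_nonneg (hnn r) (hnn s))))

/-- The Riccati feedback gain `-(Bᵀ * P)` is stabilizing. -/
theorem isHurwitz_of_riccati {ι κ : Type*} [Fintype ι] [DecidableEq ι] [Fintype κ]
    {A P : Matrix ι ι ℝ} {B : Matrix ι κ ℝ}
    (hP : P.PosDef) (hRic : P * A + Aᵀ * P - P * B * Bᵀ * P = -1) :
    IsHurwitz (A + B * -(Bᵀ * P)) := by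
  refine isHurwitz_of_lyapunov hP fun v hv => ?_
  have hT : Pᵀ = P := by simpa using hP.isHermitian.eq
  have hvv : 0 < v ⬝ᵥ v := by simpa using Matrix.dotProduct_star_self_pos_iff.2 hv
  have hq := congrArg (fun Q => v ⬝ᵥ (Q *ᵥ v)) hRic
  have h1 : v ⬝ᵥ ((Aᵀ * P) *ᵥ v) = v ⬝ᵥ ((P * A) *ᵥ v) := by
    rw [Matrix.dotProduct_mulVec, ← Matrix.mulVec_transpose, Matrix.transpose_mul, hT,
      Matrix.transpose_transpose, dotProduct_comm]
  have h2 : v ⬝ᵥ ((P * B * Bᵀ * P) *ᵥ v) = ((Bᵀ * P) *ᵥ v) ⬝ᵥ ((Bᵀ * P) *ᵥ v) := by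
    have : P * B * Bᵀ * P = (Bᵀ * P)ᵀ * (Bᵀ * P) := by
      rw [Matrix.transpose_mul, Matrix.transpose_transpose, hT]
      simp only [Matrix.mul_assoc]
    rw [this, ← Matrix.mulVec_mulVec, Matrix.dotProduct_mulVec, Matrix.vecMul_transpose]
  have h3 : 0 ≤ ((Bᵀ * P) *ᵥ v) ⬝ᵥ ((Bᵀ * P) *ᵥ v) := by
    exact Finset.sum_nonneg fun i _ => mul_self_nonneg _
  have h4 : P * (A + B * -(Bᵀ * P)) = P * A - P * B * Bᵀ * P := by
    simp only [Matrix.mul_add, Matrix.mul_neg, Matrix.mul_assoc, sub_eq_add_neg]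
  simp only [Matrix.sub_mulVec, Matrix.add_mulVec, dotProduct_sub, dotProduct_add, h1, h2,
    Matrix.neg_mulVec, Matrix.one_mulVec, dotProduct_neg] at hq
  rw [Matrix.mulVec_mulVec, h4, Matrix.sub_mulVec, dotProduct_sub, h2]
  linarith

theorem Fin.sum_univ_eq_zero_add_sum_pred {E : Type*} [AddCommMonoid E] {k : ℕ} (hk : 1 ≤ k)
    (f : Fin k → E) :
    ∑ q, f q = f ⟨0, hk⟩ + ∑ q : Fin (k - 1), f ⟨q.1 + 1, by have := q.2; omega⟩ := by
  obtain ⟨k, rfl⟩ := Nat.exists_eq_add_of_le' hk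
  exact Fin.sum_univ_succ f

section Coupling

variable {N : ℕ} {l : Fin N → ℕ} {a b : ((i : Fin N) × Fin (l i)) → ((i : Fin N) × Fin (l i)) → ℝ}
  {E : Type*} [AddCommGroup E] [Module ℝ E]

/-- The diffusive coupling term is the weighted Laplacian applied to the stacked vector. -/
theorem coupling_eq_sum_laplacian
    (hb : ∀ v w, b v w = if v = w then ∑ u, a v u else -(a v w))
    (hrow : ∀ (i j : Fin N) (p : Fin (l i)), ∑ q : Fin (l j), b ⟨i, p⟩ ⟨j, q⟩ = 0)
    (ci : Fin N → ℝ) (z : ((i : Fin N) × Fin (l i)) → E) (i : Fin N) (p : Fin (l i)) :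
    ci i • ∑ k : Fin (l i), a ⟨i, p⟩ ⟨i, k⟩ • (z ⟨i, p⟩ - z ⟨i, k⟩) +
      (∑ w : (j : Fin N) × Fin (l j), if w.1 = i then 0 else a ⟨i, p⟩ w • (z ⟨i, p⟩ - z w)) =
    ∑ j, (if i = j then ci i else 1) • ∑ q : Fin (l j), b ⟨i, p⟩ ⟨j, q⟩ • z ⟨j, q⟩ := by
  have hne : ∀ w, ⟨i, p⟩ ≠ w → b ⟨i, p⟩ w = -a ⟨i, p⟩ w := fun w hw => by rw [hb, if_neg hw]
  have hblock : ∀ j, ∑ q : Fin (l j), a ⟨i, p⟩ ⟨j, q⟩ • (z ⟨i, p⟩ - z ⟨j, q⟩) =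
      ∑ q : Fin (l j), b ⟨i, p⟩ ⟨j, q⟩ • z ⟨j, q⟩ := fun j => by
    have hterm : ∀ q : Fin (l j), a ⟨i, p⟩ ⟨j, q⟩ • (z ⟨i, p⟩ - z ⟨j, q⟩) =
        b ⟨i, p⟩ ⟨j, q⟩ • z ⟨j, q⟩ - b ⟨i, p⟩ ⟨j, q⟩ • z ⟨i, p⟩ := fun q => by
      by_cases h : (⟨i, p⟩ : (i : Fin N) × Fin (l i)) = ⟨j, q⟩
      · rw [h, ← smul_sub]
        simp
      · rw [hne _ h]
        module
    rw [Finset.sum_congr rfl fun q _ => hterm q, Finset.sum_sub_distrib, ← Finset.sum_smul,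
      hrow, zero_smul, sub_zero]
  rw [Fintype.sum_sigma, hblock i, ← Finset.add_sum_erase _ _ (Finset.mem_univ i),
    ← Finset.add_sum_erase (Finset.univ : Finset (Fin N)) _ (Finset.mem_univ i), if_pos rfl]
  simp only [if_true, Finset.sum_const_zero, zero_add]
  congr 1
  refine Finset.sum_congr rfl fun j hj => ?_
  have hji := Finset.ne_of_mem_erase hj
  simp only [if_neg hji, if_neg hji.symm, one_smul, hblock]

/-- A matrix with zero row sums acts through the differences to the first entry. -/
theorem sum_smul_eq_sum_smul_sub_first {k : ℕ} (hk : 1 ≤ k) (β : Fin k → ℝ) (hβ : ∑ q, β q = 0)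
    (z : Fin k → E) :
    ∑ q, β q • z q = ∑ q : Fin (k - 1), β ⟨q.1 + 1, by have := q.2; omega⟩ •
      (z ⟨q.1 + 1, by have := q.2; omega⟩ - z ⟨0, hk⟩) := by
  have h : ∑ q, β q • z q = ∑ q, β q • (z q - z ⟨0, hk⟩) := by
    simp only [smul_sub, Finset.sum_sub_distrib, ← Finset.sum_smul, hβ, zero_smul, sub_zero]
  rw [h, Fin.sum_univ_eq_zero_add_sum_pred hk, sub_self, smul_zero, zero_add]

end Coupling

/-- The differences of the stacked vector `z` to the first agent of each cluster. -/
def clusterDiff {n N : ℕ} {l : Fin N → ℕ} (hl : ∀ i, 1 ≤ l i)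
    (z : ((i : Fin N) × Fin (l i)) → Fin n → ℝ) :
    ((i : Fin N) × Fin (l i - 1)) × Fin n → ℝ :=
  fun r => z ⟨r.1.1, ⟨r.1.2.1 + 1, by have := r.1.2.2; omega⟩⟩ r.2 - z ⟨r.1.1, ⟨0, hl _⟩⟩ r.2

theorem clusterMatrix_mulVec_clusterDiff {n N : ℕ} {l : Fin N → ℕ} (hl : ∀ i, 1 ≤ l i)
    (A : Fin N → Matrix (Fin n) (Fin n) ℝ)
    (b : ((i : Fin N) × Fin (l i)) → ((i : Fin N) × Fin (l i)) → ℝ)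
    (hrow : ∀ (i j : Fin N) (p : Fin (l i)), ∑ q : Fin (l j), b ⟨i, p⟩ ⟨j, q⟩ = 0)
    (c : ℝ) (ci : Fin N → ℝ) (z : ((i : Fin N) × Fin (l i)) → Fin n → ℝ) :
    clusterMatrix n N l c ci A b *ᵥ clusterDiff hl z =
      clusterDiff hl fun v => A v.1 *ᵥ z v -
        c • ∑ j, (if v.1 = j then ci v.1 else 1) • ∑ q : Fin (l j), b v ⟨j, q⟩ • z ⟨j, q⟩ := by
  ext ⟨⟨i, p⟩, d⟩
  have hA : (hatA n N l A *ᵥ clusterDiff hl z) (⟨i, p⟩, d) =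
      (A i *ᵥ z ⟨i, ⟨p.1 + 1, by have := p.2; omega⟩⟩) d - (A i *ᵥ z ⟨i, ⟨0, hl i⟩⟩) d := by
    simp only [Matrix.mulVec, dotProduct, Fintype.sum_prod_type, hatA, Matrix.of_apply, ite_mul,
      zero_mul]
    rw [Finset.sum_comm]
    simp [clusterDiff, mul_sub, Finset.sum_sub_distrib]
  have hL : (kroneckerMap (· * ·) (reducedLapWeighted N l ci b)
      (1 : Matrix (Fin n) (Fin n) ℝ) *ᵥ clusterDiff hl z) (⟨i, p⟩, d) =
      ∑ j, (if i = j then ci i else 1) *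
        ∑ q : Fin (l j - 1), reducedLap N l b ⟨i, p⟩ ⟨j, q⟩ * clusterDiff hl z (⟨j, q⟩, d) := by
    simp only [Matrix.mulVec, dotProduct, Fintype.sum_prod_type, Fintype.sum_sigma,
      kroneckerMap_apply, reducedLapWeighted, Matrix.of_apply, Finset.mul_sum, mul_assoc]
    refine Finset.sum_congr rfl fun j _ => Finset.sum_congr rfl fun q _ => ?_
    simp [Matrix.one_apply]
  rw [clusterMatrix, Matrix.sub_mulVec, Matrix.smul_mulVec, Pi.sub_apply, Pi.smul_apply, hA, hL]
  have hred : ∀ (p : Fin (l i)) (j : Fin N), ∑ q : Fin (l j), b ⟨i, p⟩ ⟨j, q⟩ • z ⟨j, q⟩ = _ :=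
    fun p j => sum_smul_eq_sum_smul_sub_first (hl j) _ (hrow i j p) fun q => z ⟨j, q⟩
  simp only [clusterDiff, hred, Pi.sub_apply, Pi.smul_apply, Finset.sum_apply, smul_eq_mul,
    reducedLap, Matrix.of_apply, sub_mul, Finset.sum_sub_distrib, mul_sub]
  ring

/-- Theorem 1 (sufficiency): if `Â - c L̂_c ⊗ I_n` is Hurwitz, then for every choice of
initial conditions the closed-loop solutions of the dynamically coupled multi-agent system
achieve intra-cluster state synchronization and all auxiliary variables vanish. -/
theorem cluster_synchronization_of_isHurwitz
    (n N : ℕ) (l : Fin N → ℕ) (hl : ∀ i, 1 ≤ l i) (m : Fin N → ℕ)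
    (A : Fin N → Matrix (Fin n) (Fin n) ℝ)
    (B : (i : Fin N) → Matrix (Fin n) (Fin (m i)) ℝ)
    (P : Fin N → Matrix (Fin n) (Fin n) ℝ)
    (hP : ∀ i, (P i).PosDef)
    (hRic : ∀ i, P i * A i + (A i)ᵀ * P i - P i * B i * (B i)ᵀ * P i = -1)
    (K : (i : Fin N) → Matrix (Fin (m i)) (Fin n) ℝ)
    (hK : ∀ i, K i = -((B i)ᵀ * P i))
    (a : ((i : Fin N) × Fin (l i)) → ((i : Fin N) × Fin (l i)) → ℝ)
    (ha : ∀ v, a v v = 0)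
    (b : ((i : Fin N) × Fin (l i)) → ((i : Fin N) × Fin (l i)) → ℝ)
    (hb : ∀ v w, b v w = if v = w then ∑ u, a v u else -(a v w))
    (hrow : ∀ (i j : Fin N) (p : Fin (l i)), ∑ q : Fin (l j), b ⟨i, p⟩ ⟨j, q⟩ = 0)
    (c : ℝ) (hc : 0 < c) (ci : Fin N → ℝ) (hci : ∀ i, 0 < ci i)
    (hHur : IsHurwitz (clusterMatrix n N l c ci A b))
    (x η : ((i : Fin N) × Fin (l i)) → ℝ → (Fin n → ℝ))
    (hx : ∀ (i : Fin N) (p : Fin (l i)) (t : ℝ),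
      HasDerivAt (x ⟨i, p⟩)
        ((A i).mulVec (x ⟨i, p⟩ t) + (B i * K i).mulVec (η ⟨i, p⟩ t)) t)
    (hη : ∀ (i : Fin N) (p : Fin (l i)) (t : ℝ),
      HasDerivAt (η ⟨i, p⟩)
        ((A i + B i * K i).mulVec (η ⟨i, p⟩ t) +
          c • (ci i •
              ∑ k : Fin (l i), a ⟨i, p⟩ ⟨i, k⟩ •
                (η ⟨i, k⟩ t - η ⟨i, p⟩ t + x ⟨i, p⟩ t - x ⟨i, k⟩ t) +
            ∑ w : (j : Fin N) × Fin (l j),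
              if w.1 = i then 0 else a ⟨i, p⟩ w •
                (η w t - η ⟨i, p⟩ t + x ⟨i, p⟩ t - x w t))) t) :
    (∀ (i : Fin N) (p q : Fin (l i)),
        Tendsto (fun t => x ⟨i, p⟩ t - x ⟨i, q⟩ t) atTop (nhds 0))
    ∧ (∀ v : (i : Fin N) × Fin (l i), Tendsto (η v) atTop (nhds 0)) := by
  have hcoup : ∀ (i : Fin N) (p : Fin (l i)) (t : ℝ),
      ci i • ∑ k : Fin (l i), a ⟨i, p⟩ ⟨i, k⟩ •
          (η ⟨i, k⟩ t - η ⟨i, p⟩ t + x ⟨i, p⟩ t - x ⟨i, k⟩ t) +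
        (∑ w : (j : Fin N) × Fin (l j), if w.1 = i then 0 else a ⟨i, p⟩ w •
          (η w t - η ⟨i, p⟩ t + x ⟨i, p⟩ t - x w t)) =
      ∑ j, (if i = j then ci i else 1) • ∑ q : Fin (l j),
        b ⟨i, p⟩ ⟨j, q⟩ • (x ⟨j, q⟩ t - η ⟨j, q⟩ t) := fun i p t => by
    rw [← coupling_eq_sum_laplacian hb hrow ci (fun v => x v t - η v t) i p]
    have h : ∀ w, η w t - η ⟨i, p⟩ t + x ⟨i, p⟩ t - x w t =
      (x ⟨i, p⟩ t - η ⟨i, p⟩ t) - (x w t - η w t) := fun w => by abel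
    simp only [h]
  simp only [hcoup] at hη
  have hz : ∀ (v : (i : Fin N) × Fin (l i)) (t : ℝ), HasDerivAt (fun s => x v s - η v s)
      (A v.1 *ᵥ (x v t - η v t) - c • ∑ j, (if v.1 = j then ci v.1 else 1) • ∑ q : Fin (l j),
        b v ⟨j, q⟩ • (x ⟨j, q⟩ t - η ⟨j, q⟩ t)) t := fun ⟨i, p⟩ t => by
    refine ((hx i p t).sub (hη i p t)).congr_deriv ?_
    rw [Matrix.mulVec_sub, Matrix.add_mulVec]
    abel
  have hdiff : Tendsto (fun t => clusterDiff hl fun v => x v t - η v t) atTop (𝓝 0) := by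
    refine hHur.tendsto_zero (w := 0) (fun t => ?_) tendsto_const_nhds
    rw [Pi.zero_apply, add_zero, clusterMatrix_mulVec_clusterDiff hl A b hrow]
    exact hasDerivAt_pi.2 fun r => (hasDerivAt_pi.1 (hz _ t) r.2).sub (hasDerivAt_pi.1 (hz _ t) r.2)
  have hsucc : ∀ (i : Fin N) (q : Fin (l i - 1)), Tendsto (fun t =>
      (x ⟨i, ⟨q.1 + 1, by have := q.2; omega⟩⟩ t - η ⟨i, ⟨q.1 + 1, by have := q.2; omega⟩⟩ t) -
        (x ⟨i, ⟨0, hl i⟩⟩ t - η ⟨i, ⟨0, hl i⟩⟩ t)) atTop (𝓝 0) := fun i q =>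
    tendsto_pi_nhds.2 fun d => tendsto_pi_nhds.1 hdiff (⟨i, q⟩, d)
  have hη0 : ∀ v, Tendsto (η v) atTop (𝓝 0) := fun ⟨i, p⟩ => by
    have hH : IsHurwitz (A i + B i * K i) := hK i ▸ isHurwitz_of_riccati (hP i) (hRic i)
    refine hH.tendsto_zero (hη i p) ?_
    have hsum : ∀ t, ∑ j, (if i = j then ci i else 1) • ∑ q : Fin (l j),
        b ⟨i, p⟩ ⟨j, q⟩ • (x ⟨j, q⟩ t - η ⟨j, q⟩ t) = _ := fun t =>
      Finset.sum_congr rfl fun j _ => congrArg _ <|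
        sum_smul_eq_sum_smul_sub_first (hl j) _ (hrow i j p) fun q => x ⟨j, q⟩ t - η ⟨j, q⟩ t
    simp only [hsum]
    have hlim := (tendsto_finsetSum Finset.univ fun (j : Fin N) _ =>
      (tendsto_finsetSum Finset.univ fun (q : Fin (l j - 1)) _ => (hsucc j q).const_smul
        (b ⟨i, p⟩ ⟨j, ⟨q.1 + 1, by have := q.2; omega⟩⟩)).const_smul
          (if i = j then ci i else 1)).const_smul c
    simpa using hlim
  refine ⟨fun i p q => ?_, hη0⟩
  have hfirst : ∀ p : Fin (l i), Tendsto (fun t => (x ⟨i, p⟩ t - η ⟨i, p⟩ t) -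
      (x ⟨i, ⟨0, hl i⟩⟩ t - η ⟨i, ⟨0, hl i⟩⟩ t)) atTop (𝓝 0) := by
    rintro ⟨_ | p, hp⟩
    · simp
    · exact hsucc i ⟨p, by omega⟩
  have hlim := ((hfirst p).sub (hfirst q)).add ((hη0 ⟨i, p⟩).sub (hη0 ⟨i, q⟩))
  simp only [sub_zero, add_zero] at hlim
  exact hlim.congr fun t => by abel
end

section
/- Consider the multi-agent system of N clusters with the dynamic coupling law, where for each i the gain is K_i = −B_iᵀP_i with P_i symmetric positive definite solving P_iA_i + A_iᵀP_i − P_iB_iB_iᵀP_i = −I, and every block L_{ij} of the graph Laplacian has zero row sums. If for every choice of initial conditions x_l(0), η_l(0) (l = 1,…,L) the closed-loop solutions satisfy x_l(t) − x_k(t) → 0 as t → ∞ for all l,k in the same cluster and η_l(t) → 0 as t → ∞ for every l, then the matrix Â − c L̂_c ⊗ I_n is Hurwitz. -/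
open Matrix Filter Topology

/-- Linear autonomous differential equations on a finite-dimensional space have global solutions
for every initial value. -/
theorem exists_linear_flow {E : Type*} [NormedAddCommGroup E] [NormedSpace ℝ E]
    [FiniteDimensional ℝ E] (f : E →ₗ[ℝ] E) (y₀ : E) :
    ∃ y : ℝ → E, y 0 = y₀ ∧ ∀ t, HasDerivAt y (f (y t)) t := by
  have : CompleteSpace E := FiniteDimensional.complete ℝ E
  refine ⟨fun t => NormedSpace.exp (t • LinearMap.toContinuousLinearMap f) y₀, by simp, fun t => ?_⟩
  simpa using (hasDerivAt_exp_smul_const' (𝕂 := ℝ) (LinearMap.toContinuousLinearMap f) t).clm_apply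
    (hasDerivAt_const t y₀)

/-- If every initial value starts a trajectory of `ė = M e` that converges to zero, then `M` is
Hurwitz. -/
theorem isHurwitz_of_forall_exists_tendsto_zero {ι : Type*} [Fintype ι] [DecidableEq ι]
    (M : Matrix ι ι ℝ)
    (h : ∀ e₀ : ι → ℝ, ∃ e : ℝ → ι → ℝ, e 0 = e₀ ∧ (∀ t, HasDerivAt e (M *ᵥ e t) t) ∧
      Tendsto e atTop (𝓝 0)) : IsHurwitz M := by
  intro μ hμ
  by_contra! hre
  obtain ⟨w, hw0, hw⟩ : ∃ w : ι → ℂ, w ≠ 0 ∧ w ᵥ* M.map Complex.ofReal = μ • w := by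
    rw [spectrum.mem_iff, Matrix.isUnit_iff_isUnit_det, isUnit_iff_ne_zero, not_not] at hμ
    obtain ⟨w, hw0, hw⟩ := Matrix.exists_vecMul_eq_zero_iff.mpr hμ
    refine ⟨w, hw0, ?_⟩
    rw [Matrix.vecMul_sub, sub_eq_zero, Algebra.algebraMap_eq_smul_one, Matrix.vecMul_smul,
      Matrix.vecMul_one] at hw
    exact hw.symm
  obtain ⟨i, hi⟩ := Function.ne_iff.mp hw0
  obtain ⟨e, he0, hde, hlim⟩ := h (Pi.single i 1)
  set φ : ℝ → ℂ := fun t => w ⬝ᵥ fun j => (e t j : ℂ) with hφ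
  have hφ0 : φ 0 = w i := by
    simp [hφ, he0, dotProduct, Pi.single_apply, apply_ite]
  have hdφ : ∀ t, HasDerivAt φ (μ * φ t) t := by
    intro t
    have hsum : HasDerivAt φ (w ⬝ᵥ fun j => ((M *ᵥ e t) j : ℂ)) t := by
      refine HasDerivAt.fun_sum fun j _ => HasDerivAt.const_mul _ ?_
      exact (hasDerivAt_pi.mp (hde t) j).ofReal_comp
    convert hsum using 1
    have hmap : (fun j => ((M *ᵥ e t) j : ℂ)) =
        M.map Complex.ofReal *ᵥ fun j => (e t j : ℂ) := by
      ext j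
      simp [mulVec, dotProduct]
    rw [hmap, dotProduct_mulVec, hw, smul_dotProduct, smul_eq_mul]
  have hconst : ∀ t : ℝ, Complex.exp (-(μ * t)) * φ t = w i := by
    have hd : ∀ t : ℝ, HasDerivAt (fun t : ℝ => Complex.exp (-(μ * t)) * φ t) 0 t := by
      intro t
      have h1 : HasDerivAt (fun t : ℝ => -(μ * (t : ℂ))) (-(μ * 1)) t :=
        ((hasDerivAt_id t).ofReal_comp.const_mul μ).neg
      refine (h1.cexp.mul (hdφ t)).congr_deriv ?_
      ring
    intro t
    have := is_const_of_deriv_eq_zero (fun t => (hd t).differentiableAt) (fun t => (hd t).deriv) t 0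
    simpa [hφ0] using this
  have hφlim : Tendsto φ atTop (𝓝 0) := by
    have : Tendsto φ atTop (𝓝 (∑ j, w j * ((0 : ℝ) : ℂ))) := by
      refine tendsto_finsetSum _ fun j _ => Tendsto.const_mul _ ?_
      exact (Complex.continuous_ofReal.tendsto 0).comp (tendsto_pi_nhds.mp hlim j)
    simpa using this
  have hbound : ∀ᶠ t in atTop, ‖w i‖ ≤ ‖φ t‖ := by
    filter_upwards [eventually_ge_atTop 0] with t ht
    rw [← hconst t, norm_mul, Complex.norm_exp]
    refine mul_le_of_le_one_left (norm_nonneg _) (Real.exp_le_one_iff.mpr ?_)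
    simpa using mul_nonneg hre ht
  have := ge_of_tendsto hφlim.norm hbound
  simp only [norm_zero] at this
  exact hi (norm_le_zero_iff.mp this)

/-- Summation against weights of zero total only sees differences to the first entry. -/
theorem sum_mul_eq_sum_mul_sub_zero {k : ℕ} (hk : 1 ≤ k) (f g : Fin k → ℝ) (hf : ∑ q, f q = 0) :
    ∑ q, f q * g q = ∑ q : Fin (k - 1), f ⟨q.1 + 1, by have := q.2; omega⟩ *
      (g ⟨q.1 + 1, by have := q.2; omega⟩ - g ⟨0, hk⟩) := by
  obtain ⟨k, rfl⟩ : ∃ k', k = k' + 1 := ⟨k - 1, by omega⟩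
  have h : ∑ q, f q * g q = ∑ q, f q * (g q - g 0) := by
    simp [mul_sub, Finset.sum_sub_distrib, ← Finset.sum_mul, hf]
  rw [h, Fin.sum_univ_succ]
  simp
  rfl

section Cluster

variable {N : ℕ} {l : Fin N → ℕ}

/-- The member of a cluster with the given positive position. -/
def clusterSucc (p : (i : Fin N) × Fin (l i - 1)) : (i : Fin N) × Fin (l i) :=
  ⟨p.1, ⟨p.2.1 + 1, by have := p.2.2; omega⟩⟩

/-- The first member of a cluster. -/
def clusterFirst (hl : ∀ i, 1 ≤ l i) (i : Fin N) : (i : Fin N) × Fin (l i) :=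
  ⟨i, ⟨0, hl i⟩⟩

/-- The weighted diffusive coupling acting on one coordinate of the agent states. -/
noncomputable def clusterCoupling (ci : Fin N → ℝ)
    (a : ((i : Fin N) × Fin (l i)) → ((i : Fin N) × Fin (l i)) → ℝ)
    (z : ((i : Fin N) × Fin (l i)) → ℝ) (v : (i : Fin N) × Fin (l i)) : ℝ :=
  ci v.1 * ∑ k : Fin (l v.1), a v ⟨v.1, k⟩ * (z v - z ⟨v.1, k⟩) +
    ∑ w : (j : Fin N) × Fin (l j), if w.1 = v.1 then 0 else a v w * (z v - z w)

theorem clusterCoupling_eq_sum_sub_first (hl : ∀ i, 1 ≤ l i) (ci : Fin N → ℝ)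
    {a b : ((i : Fin N) × Fin (l i)) → ((i : Fin N) × Fin (l i)) → ℝ}
    (hb : ∀ v w, b v w = if v = w then ∑ u, a v u else -(a v w))
    (hrow : ∀ (i j : Fin N) (p : Fin (l i)), ∑ q : Fin (l j), b ⟨i, p⟩ ⟨j, q⟩ = 0)
    (z : ((i : Fin N) × Fin (l i)) → ℝ) (v : (i : Fin N) × Fin (l i)) :
    clusterCoupling ci a z v = ∑ q : (j : Fin N) × Fin (l j - 1),
      (if v.1 = q.1 then ci v.1 else 1) * b v (clusterSucc q) *
        (z (clusterSucc q) - z (clusterFirst hl q.1)) := by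
  have hblock : ∀ j, ∑ q : Fin (l j), a v ⟨j, q⟩ * (z v - z ⟨j, q⟩) =
      ∑ q : Fin (l j - 1), b v (clusterSucc ⟨j, q⟩) *
        (z (clusterSucc ⟨j, q⟩) - z (clusterFirst hl j)) := by
    intro j
    have hpt : ∀ w, a v w * (z v - z w) = b v w * z w - b v w * z v := by
      intro w
      rw [hb]
      split_ifs with h
      · simp [h]
      · ring
    simp_rw [hpt]
    rw [Finset.sum_sub_distrib, ← Finset.sum_mul, hrow v.1 j v.2, zero_mul, sub_zero,
      sum_mul_eq_sum_mul_sub_zero (hl j) _ _ (hrow v.1 j v.2)]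
    rfl
  have hout : (∑ w : (j : Fin N) × Fin (l j), if w.1 = v.1 then 0 else a v w * (z v - z w)) =
      ∑ j : Fin N, if v.1 = j then 0 else ∑ q : Fin (l j), a v ⟨j, q⟩ * (z v - z ⟨j, q⟩) := by
    rw [Fintype.sum_sigma]
    refine Finset.sum_congr rfl fun j _ => ?_
    by_cases h : v.1 = j
    · simp [h]
    · simp [h, Ne.symm h]
  have hin : ci v.1 * ∑ k : Fin (l v.1), a v ⟨v.1, k⟩ * (z v - z ⟨v.1, k⟩) =
      ∑ j : Fin N, if v.1 = j then
        ci v.1 * ∑ q : Fin (l j), a v ⟨j, q⟩ * (z v - z ⟨j, q⟩) else 0 := by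
    simp
  rw [clusterCoupling, hin, hout, ← Finset.sum_add_distrib, Fintype.sum_sigma]
  refine Finset.sum_congr rfl fun j _ => ?_
  by_cases h : v.1 = j
  · simp [h, hblock, Finset.mul_sum, mul_assoc]
  · simp [h, hblock]

/-- In the coordinates relative to the first cluster members, the diffusively coupled vector field
is given by `clusterMatrix`. -/
theorem clusterMatrix_mulVec_sub_first {n : ℕ} (hl : ∀ i, 1 ≤ l i) (c : ℝ) (ci : Fin N → ℝ)
    (A : Fin N → Matrix (Fin n) (Fin n) ℝ)
    {a b : ((i : Fin N) × Fin (l i)) → ((i : Fin N) × Fin (l i)) → ℝ}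
    (hb : ∀ v w, b v w = if v = w then ∑ u, a v u else -(a v w))
    (hrow : ∀ (i j : Fin N) (p : Fin (l i)), ∑ q : Fin (l j), b ⟨i, p⟩ ⟨j, q⟩ = 0)
    (z : ((i : Fin N) × Fin (l i)) → Fin n → ℝ) (s : ((i : Fin N) × Fin (l i - 1)) × Fin n) :
    (clusterMatrix n N l c ci A b *ᵥ
        fun s => z (clusterSucc s.1) s.2 - z (clusterFirst hl s.1.1) s.2) s =
      ((A s.1.1 *ᵥ z (clusterSucc s.1)) s.2 -
          c * clusterCoupling ci a (fun v => z v s.2) (clusterSucc s.1)) -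
        ((A s.1.1 *ᵥ z (clusterFirst hl s.1.1)) s.2 -
          c * clusterCoupling ci a (fun v => z v s.2) (clusterFirst hl s.1.1)) := by
  obtain ⟨p, r⟩ := s
  rw [clusterCoupling_eq_sum_sub_first hl ci hb hrow, clusterCoupling_eq_sum_sub_first hl ci hb hrow]
  have hA : (hatA n N l A *ᵥ
      fun s => z (clusterSucc s.1) s.2 - z (clusterFirst hl s.1.1) s.2) (p, r) =
      (A p.1 *ᵥ z (clusterSucc p)) r - (A p.1 *ᵥ z (clusterFirst hl p.1)) r := by
    rw [mulVec, dotProduct, Fintype.sum_prod_type, Finset.sum_eq_single p]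
    · simp [hatA, mulVec, dotProduct, mul_sub, Finset.sum_sub_distrib]
    · intro q _ hq
      simp [hatA, hq.symm]
    · simp
  have hL : (Matrix.kroneckerMap (· * ·) (reducedLapWeighted N l ci b)
      (1 : Matrix (Fin n) (Fin n) ℝ) *ᵥ
      fun s => z (clusterSucc s.1) s.2 - z (clusterFirst hl s.1.1) s.2) (p, r) =
      ∑ q, reducedLapWeighted N l ci b p q *
        (z (clusterSucc q) r - z (clusterFirst hl q.1) r) := by
    rw [mulVec, dotProduct, Fintype.sum_prod_type]
    simp [Matrix.one_apply]
  rw [clusterMatrix, sub_mulVec, smul_mulVec, Pi.sub_apply, Pi.smul_apply, hA, hL, smul_eq_mul]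
  have hsplit : ∀ q, reducedLapWeighted N l ci b p q =
      (if p.1 = q.1 then ci p.1 else 1) * b (clusterSucc p) (clusterSucc q) -
        (if p.1 = q.1 then ci p.1 else 1) * b (clusterFirst hl p.1) (clusterSucc q) :=
    fun q => mul_sub _ _ _
  simp only [hsplit, sub_mul _ _ (_ - _), Finset.sum_sub_distrib]
  rw [mul_sub]
  exact sub_sub_sub_comm _ _ _ _

end Cluster

/-- Theorem 1 (necessity): if for every choice of initial conditions the closed-loop
solutions of the dynamically coupled multi-agent system achieve intra-cluster state
synchronization and all auxiliary variables vanish, then `Â - c L̂_c ⊗ I_n` is Hurwitz. -/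
theorem isHurwitz_of_cluster_synchronization
    (n N : ℕ) (l : Fin N → ℕ) (hl : ∀ i, 1 ≤ l i) (m : Fin N → ℕ)
    (A : Fin N → Matrix (Fin n) (Fin n) ℝ)
    (B : (i : Fin N) → Matrix (Fin n) (Fin (m i)) ℝ)
    (P : Fin N → Matrix (Fin n) (Fin n) ℝ)
    (hP : ∀ i, (P i).PosDef)
    (hRic : ∀ i, P i * A i + (A i)ᵀ * P i - P i * B i * (B i)ᵀ * P i = -1)
    (K : (i : Fin N) → Matrix (Fin (m i)) (Fin n) ℝ)
    (hK : ∀ i, K i = -((B i)ᵀ * P i))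
    (a : ((i : Fin N) × Fin (l i)) → ((i : Fin N) × Fin (l i)) → ℝ)
    (ha : ∀ v, a v v = 0)
    (b : ((i : Fin N) × Fin (l i)) → ((i : Fin N) × Fin (l i)) → ℝ)
    (hb : ∀ v w, b v w = if v = w then ∑ u, a v u else -(a v w))
    (hrow : ∀ (i j : Fin N) (p : Fin (l i)), ∑ q : Fin (l j), b ⟨i, p⟩ ⟨j, q⟩ = 0)
    (c : ℝ) (hc : 0 < c) (ci : Fin N → ℝ) (hci : ∀ i, 0 < ci i)
    (hsync : ∀ x η : ((i : Fin N) × Fin (l i)) → ℝ → (Fin n → ℝ),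
      (∀ (i : Fin N) (p : Fin (l i)) (t : ℝ),
        HasDerivAt (x ⟨i, p⟩)
          ((A i).mulVec (x ⟨i, p⟩ t) + (B i * K i).mulVec (η ⟨i, p⟩ t)) t) →
      (∀ (i : Fin N) (p : Fin (l i)) (t : ℝ),
        HasDerivAt (η ⟨i, p⟩)
          ((A i + B i * K i).mulVec (η ⟨i, p⟩ t) +
            c • (ci i •
                ∑ k : Fin (l i), a ⟨i, p⟩ ⟨i, k⟩ •
                  (η ⟨i, k⟩ t - η ⟨i, p⟩ t + x ⟨i, p⟩ t - x ⟨i, k⟩ t) +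
              ∑ w : (j : Fin N) × Fin (l j),
                if w.1 = i then 0 else a ⟨i, p⟩ w •
                  (η w t - η ⟨i, p⟩ t + x ⟨i, p⟩ t - x w t))) t) →
      ((∀ (i : Fin N) (p q : Fin (l i)),
          Filter.Tendsto (fun t => x ⟨i, p⟩ t - x ⟨i, q⟩ t) Filter.atTop (nhds 0))
        ∧ (∀ v : (i : Fin N) × Fin (l i), Filter.Tendsto (η v) Filter.atTop (nhds 0)))) :
    IsHurwitz (clusterMatrix n N l c ci A b) := by
  apply isHurwitz_of_forall_exists_tendsto_zero
  intro e₀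
  let V := (i : Fin N) × Fin (l i)
  let E := (V → Fin n → ℝ) × (V → Fin n → ℝ)
  let X : V → E →ₗ[ℝ] (Fin n → ℝ) := fun v => LinearMap.proj v ∘ₗ LinearMap.fst ℝ _ _
  let H : V → E →ₗ[ℝ] (Fin n → ℝ) := fun v => LinearMap.proj v ∘ₗ LinearMap.snd ℝ _ _
  let fX : V → E →ₗ[ℝ] (Fin n → ℝ) := fun v =>
    (A v.1).mulVecLin ∘ₗ X v + (B v.1 * K v.1).mulVecLin ∘ₗ H v
  let fH : V → E →ₗ[ℝ] (Fin n → ℝ) := fun v =>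
    (A v.1 + B v.1 * K v.1).mulVecLin ∘ₗ H v +
      c • (ci v.1 • ∑ k : Fin (l v.1), a v ⟨v.1, k⟩ • (H ⟨v.1, k⟩ - H v + X v - X ⟨v.1, k⟩) +
        ∑ w : V, if w.1 = v.1 then 0 else a v w • (H w - H v + X v - X w))
  let x₀ : V → Fin n → ℝ := fun v r =>
    if h : v.2.1 = 0 then 0 else e₀ (⟨v.1, ⟨v.2.1 - 1, by have := v.2.2; omega⟩⟩, r)
  have hfH : ∀ v u, fH v u = (A v.1 + B v.1 * K v.1) *ᵥ u.2 v +
      c • (ci v.1 • ∑ k : Fin (l v.1),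
          a v ⟨v.1, k⟩ • (u.2 ⟨v.1, k⟩ - u.2 v + u.1 v - u.1 ⟨v.1, k⟩) +
        ∑ w : V, if w.1 = v.1 then 0 else a v w • (u.2 w - u.2 v + u.1 v - u.1 w)) := by
    intro v u
    have hX : ∀ v, X v u = u.1 v := fun _ => rfl
    have hH : ∀ v, H v u = u.2 v := fun _ => rfl
    simp only [fH, LinearMap.add_apply, LinearMap.smul_apply, LinearMap.sum_apply,
      LinearMap.sub_apply, LinearMap.comp_apply, mulVecLin_apply, hX, hH,
      apply_ite (fun g : E →ₗ[ℝ] (Fin n → ℝ) => g u), LinearMap.zero_apply]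
  obtain ⟨y, hy0, hy⟩ := exists_linear_flow ((LinearMap.pi fX).prod (LinearMap.pi fH)) (x₀, 0)
  have hx : ∀ v t, HasDerivAt (fun t => (y t).1 v) (fX v (y t)) t := fun v t =>
    hasDerivAt_pi.mp (hy t).fst v
  have hη : ∀ v t, HasDerivAt (fun t => (y t).2 v) (fH v (y t)) t := fun v t =>
    hasDerivAt_pi.mp (hy t).snd v
  obtain ⟨hxlim, hηlim⟩ := hsync (fun v t => (y t).1 v) (fun v t => (y t).2 v)
    (fun i p t => hx ⟨i, p⟩ t) (fun i p t => hfH ⟨i, p⟩ (y t) ▸ hη ⟨i, p⟩ t)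
  let z : ℝ → V → Fin n → ℝ := fun t v => (y t).1 v - (y t).2 v
  have hz : ∀ v r t, HasDerivAt (fun t => z t v r)
      ((A v.1 *ᵥ z t v) r - c * clusterCoupling ci a (fun w => z t w r) v) t := by
    intro v r t
    refine (hasDerivAt_pi.mp ((hx v t).sub (hη v t)) r).congr_deriv ?_
    have hterm : ∀ w : V, (y t).2 w r - (y t).2 v r + (y t).1 v r - (y t).1 w r =
        (y t).1 v r - (y t).2 v r - ((y t).1 w r - (y t).2 w r) := fun w => by ring
    have hfX : fX v (y t) = A v.1 *ᵥ (y t).1 v + (B v.1 * K v.1) *ᵥ (y t).2 v := rfl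
    simp only [hfX, hfH, clusterCoupling, z, add_mulVec, mulVec_sub, Pi.sub_apply, Pi.add_apply,
      Pi.smul_apply, Finset.sum_apply, smul_eq_mul, Pi.zero_apply, hterm,
      apply_ite (fun g : Fin n → ℝ => g r)]
    ring
  refine ⟨fun t s => z t (clusterSucc s.1) s.2 - z t (clusterFirst hl s.1.1) s.2, ?_, fun t => ?_, ?_⟩
  · ext s
    simp [z, hy0, x₀, clusterSucc, clusterFirst]
  · refine hasDerivAt_pi.mpr fun s => ?_
    rw [clusterMatrix_mulVec_sub_first hl c ci A hb hrow (z t) s]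
    exact (hz _ _ t).sub (hz _ _ t)
  · refine tendsto_pi_nhds.mpr fun s => ?_
    have hlim := (hxlim s.1.1 (clusterSucc s.1).2 (clusterFirst hl s.1.1).2).sub
      ((hηlim (clusterSucc s.1)).sub (hηlim (clusterFirst hl s.1.1)))
    convert tendsto_pi_nhds.mp hlim s.2 using 1
    · ext t
      simp only [z, Pi.sub_apply]
      exact sub_sub_sub_comm _ _ _ _
    · simp
end

section
/- Let M ∈ ℝ^{l×l} be the Laplacian of a nonnegatively weighted directed graph on l nodes: M has zero row sums and M_{jk} ≤ 0 for all j ≠ k (so the weight of the edge from node k to node j is a_{jk} = −M_{jk} ≥ 0). Then the following are equivalent: (i) 0 is an eigenvalue of M of algebraic multiplicity exactly one and every nonzero eigenvalue of M (over ℂ) has positive real part; (ii) the graph contains a directed spanning tree, i.e. there exists a node r such that every node j is reachable from r by a directed path along edges (k → j) with M_{jk} < 0. -/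
open Matrix

section Laplacian

lemma laplacian_term_nonneg_of_isMax {n : Type*} {M : Matrix n n ℝ}
    (hoff : ∀ j k, j ≠ k → M j k ≤ 0) {v : n → ℝ} {j : n} (hj : ∀ k, v k ≤ v j) (k : n) :
    0 ≤ M j k * (v k - v j) := by
  obtain rfl | hjk := eq_or_ne j k
  · simp
  · exact mul_nonneg_of_nonpos_of_nonpos (hoff j k hjk) (sub_nonpos.2 (hj k))

variable {n : Type*} [Fintype n] {M : Matrix n n ℝ}

lemma laplacian_mulVec_apply (hrow : ∀ j, ∑ k, M j k = 0) (v : n → ℝ) (j : n) :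
    (M *ᵥ v) j = ∑ k, M j k * (v k - v j) := by
  simp [Matrix.mulVec, dotProduct, mul_sub, Finset.sum_sub_distrib, ← Finset.sum_mul, hrow]

lemma laplacian_mulVec_nonneg_of_isMax (hrow : ∀ j, ∑ k, M j k = 0)
    (hoff : ∀ j k, j ≠ k → M j k ≤ 0) {v : n → ℝ} {j : n} (hj : ∀ k, v k ≤ v j) :
    0 ≤ (M *ᵥ v) j := by
  rw [laplacian_mulVec_apply hrow]
  exact Finset.sum_nonneg fun k _ => laplacian_term_nonneg_of_isMax hoff hj k

/-- A maximum of a kernel vector propagates backwards along directed paths, hence to a root. -/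
lemma laplacian_le_root_of_mulVec_eq_zero (hrow : ∀ j, ∑ k, M j k = 0)
    (hoff : ∀ j k, j ≠ k → M j k ≤ 0) {v : n → ℝ} (hv : M *ᵥ v = 0) {r : n}
    (hr : ∀ j, Relation.ReflTransGen (fun k j => M j k < 0) r j) (k : n) :
    v k ≤ v r := by
  have : Nonempty n := ⟨r⟩
  obtain ⟨m, hm⟩ := Finite.exists_max v
  refine (hr m).head_induction_on (motive := fun a _ => ∀ k, v k ≤ v a) hm ?_ k
  intro a c hac _ hc k
  have hsum := congrFun hv c
  rw [laplacian_mulVec_apply hrow, Pi.zero_apply, Finset.sum_eq_zero_iff_of_nonneg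
    fun k _ => laplacian_term_nonneg_of_isMax hoff hc k] at hsum
  have hva : v a - v c = 0 :=
    (mul_eq_zero.1 (hsum a (Finset.mem_univ a))).resolve_left hac.ne
  rw [sub_eq_zero.1 hva]
  exact hc k

lemma laplacian_apply_eq_root_of_mulVec_eq_zero (hrow : ∀ j, ∑ k, M j k = 0)
    (hoff : ∀ j k, j ≠ k → M j k ≤ 0) {v : n → ℝ} (hv : M *ᵥ v = 0) {r : n}
    (hr : ∀ j, Relation.ReflTransGen (fun k j => M j k < 0) r j) (k : n) :
    v k = v r := by
  have hneg : M *ᵥ (-v) = 0 := by rw [Matrix.mulVec_neg, hv, neg_zero]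
  exact le_antisymm (laplacian_le_root_of_mulVec_eq_zero hrow hoff hv hr k)
    (neg_le_neg_iff.1 (laplacian_le_root_of_mulVec_eq_zero hrow hoff hneg hr k))

/-- A Laplacian takes no vector to a nonzero constant vector. -/
lemma laplacian_const_eq_zero (hrow : ∀ j, ∑ k, M j k = 0)
    (hoff : ∀ j k, j ≠ k → M j k ≤ 0) [Nonempty n] {v : n → ℝ} {c : ℝ}
    (hv : ∀ j, (M *ᵥ v) j = c) : c = 0 := by
  obtain ⟨a, ha⟩ := Finite.exists_max v
  obtain ⟨b, hb⟩ := Finite.exists_min v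
  refine le_antisymm ?_ (hv a ▸ laplacian_mulVec_nonneg_of_isMax hrow hoff ha)
  have h := laplacian_mulVec_nonneg_of_isMax hrow hoff (v := -v) (j := b)
    fun k => neg_le_neg (hb k)
  rw [Matrix.mulVec_neg, Pi.neg_apply, hv b] at h
  linarith

/-- A nonempty set of nodes without incoming edges supports a nonzero left kernel vector. -/
lemma laplacian_exists_vecMul_eq_zero_of_closed [DecidableEq n] (hrow : ∀ j, ∑ k, M j k = 0)
    (hoff : ∀ j k, j ≠ k → M j k ≤ 0) {S : Set n} (hS : S.Nonempty)
    (hclosed : ∀ j ∈ S, ∀ k, M j k < 0 → k ∈ S) :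
    ∃ w : n → ℝ, w ≠ 0 ∧ w ᵥ* M = 0 ∧ ∀ j ∉ S, w j = 0 := by
  classical
  have hout : ∀ j ∈ S, ∀ k ∉ S, M j k = 0 := fun j hj k hk =>
    le_antisymm (hoff j k fun h => hk (h ▸ hj)) (not_lt.1 fun h => hk (hclosed j hj k h))
  let N : Matrix n n ℝ := fun j k => if j ∈ S then M j k else (1 : Matrix n n ℝ) j k
  have hN : ∃ v, v ≠ 0 ∧ N *ᵥ v = 0 := by
    obtain ⟨s, hs⟩ := hS
    refine ⟨S.indicator 1, fun h => ?_, funext fun j => ?_⟩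
    · simpa [hs] using congrFun h s
    · by_cases hj : j ∈ S
      · rw [Pi.zero_apply, ← hrow j]
        refine Finset.sum_congr rfl fun k _ => ?_
        by_cases hk : k ∈ S
        · simp [N, hj, hk]
        · simp [N, hj, hk, hout j hj k hk]
      · simp [N, hj, Matrix.mulVec, dotProduct, Matrix.one_apply]
  obtain ⟨w, hw, hwN⟩ := Matrix.exists_vecMul_eq_zero_iff.2 (Matrix.exists_mulVec_eq_zero_iff.1 hN)
  have hsupp : ∀ k ∉ S, w k = 0 := fun k hk => by
    have h := congrFun hwN k
    rw [Matrix.vecMul, dotProduct, Finset.sum_eq_single k] at h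
    · simpa [N, hk] using h
    · intro j _ hjk
      by_cases hj : j ∈ S
      · simp [N, hj, hout j hj k hk]
      · simp [N, hj, hjk]
    · simp
  refine ⟨w, hw, ?_, hsupp⟩
  rw [← hwN]
  refine funext fun k => Finset.sum_congr rfl fun j _ => ?_
  by_cases hj : j ∈ S
  · simp [N, hj]
  · simp [hsupp j hj]

/-- A finite directed graph in which any two nodes have a common ancestor has a root. -/
lemma exists_root_of_common_ancestor {α : Type*} [Finite α] [Nonempty α] {E : α → α → Prop}
    (h : ∀ a b, ∃ c, Relation.ReflTransGen E c a ∧ Relation.ReflTransGen E c b) :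
    ∃ r, ∀ j, Relation.ReflTransGen E r j := by
  have : IsTrans α fun a b => Relation.ReflTransGen E b a := ⟨fun _ _ _ hab hbc => hbc.trans hab⟩
  have hdir : Directed (fun a b => Relation.ReflTransGen E b a) (id : α → α) := h
  exact hdir.finite_le id

lemma laplacian_exists_root_of_rootMultiplicity_eq_one [DecidableEq n]
    (hrow : ∀ j, ∑ k, M j k = 0) (hoff : ∀ j k, j ≠ k → M j k ≤ 0)
    (hmul : Polynomial.rootMultiplicity (0 : ℝ) M.charpoly = 1) :
    ∃ r, ∀ j, Relation.ReflTransGen (fun k j => M j k < 0) r j := by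
  have : Nonempty n := by
    by_contra h
    have := not_nonempty_iff.1 h
    rw [Matrix.charpoly_isEmpty, ← Polynomial.C_1, Polynomial.rootMultiplicity_C] at hmul
    exact zero_ne_one hmul
  have hker : Module.finrank ℝ (Module.End.eigenspace (Matrix.toLin' Mᵀ) 0) ≤ 1 := by
    refine (LinearMap.finrank_eigenspace_le _ _).trans_eq ?_
    rw [Matrix.charpoly_toLin', Matrix.charpoly_transpose, hmul]
  obtain ⟨v, hv⟩ := finrank_le_one_iff.1 hker
  by_contra hroot
  obtain ⟨a, b, hab⟩ : ∃ a b, ∀ c, Relation.ReflTransGen (fun k j => M j k < 0) c a →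
      ¬ Relation.ReflTransGen (fun k j => M j k < 0) c b := by
    by_contra! h
    exact hroot (exists_root_of_common_ancestor h)
  have ancestors (a : n) := laplacian_exists_vecMul_eq_zero_of_closed hrow hoff
    (S := {c | Relation.ReflTransGen (fun k j => M j k < 0) c a}) ⟨a, .refl⟩
    fun j hj k hk => .head hk hj
  have multiple {w : n → ℝ} (hw : w ᵥ* M = 0) : ∃ c : ℝ, c • (v : n → ℝ) = w := by
    obtain ⟨c, hc⟩ := hv ⟨w, by
      simpa [Module.End.mem_eigenspace_iff, Matrix.mulVec_transpose] using hw⟩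
    exact ⟨c, congrArg Subtype.val hc⟩
  obtain ⟨w, hw, hwM, hwS⟩ := ancestors a
  obtain ⟨u, hu, huM, huS⟩ := ancestors b
  obtain ⟨c, rfl⟩ := multiple hwM
  obtain ⟨d, rfl⟩ := multiple huM
  obtain ⟨i, hi⟩ := Function.ne_iff.1 hw
  have hia : Relation.ReflTransGen (fun k j => M j k < 0) i a := by
    by_contra h
    exact hi (hwS i h)
  have hvi : (v : n → ℝ) i ≠ 0 := fun h => hi (by simp [h])
  have hd : d = 0 := by simpa [hvi] using huS i (hab i hia)
  exact hu (by rw [hd, zero_smul])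

lemma laplacian_rootMultiplicity_eq_one_of_root [DecidableEq n]
    (hrow : ∀ j, ∑ k, M j k = 0) (hoff : ∀ j k, j ≠ k → M j k ≤ 0) {r : n}
    (hr : ∀ j, Relation.ReflTransGen (fun k j => M j k < 0) r j) :
    Polynomial.rootMultiplicity (0 : ℝ) M.charpoly = 1 := by
  have : Nonempty n := ⟨r⟩
  have hker (k : ℕ) : ∀ x, (Matrix.toLin' M ^ k) x = 0 → M *ᵥ x = 0 := by
    induction k with
    | zero => intro x hx; simp_all
    | succ k ih =>
      intro x hx
      have hconst := laplacian_apply_eq_root_of_mulVec_eq_zero hrow hoff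
        (ih (M *ᵥ x) (by simpa [pow_succ] using hx)) hr
      funext j
      rw [hconst j, Pi.zero_apply]
      exact laplacian_const_eq_zero hrow hoff hconst
  have hspan : Module.End.maxGenEigenspace (Matrix.toLin' M) 0 = ℝ ∙ (1 : n → ℝ) := by
    ext x
    rw [Module.End.mem_maxGenEigenspace, Submodule.mem_span_singleton]
    constructor
    · rintro ⟨k, hk⟩
      refine ⟨x r, funext fun j => ?_⟩
      rw [laplacian_apply_eq_root_of_mulVec_eq_zero hrow hoff (hker k x (by simpa using hk)) hr j]
      simp
    · rintro ⟨c, rfl⟩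
      refine ⟨1, funext fun j => ?_⟩
      simp [Matrix.mulVec, dotProduct, hrow]
  rw [← Matrix.charpoly_toLin', ← LinearMap.finrank_maxGenEigenspace_eq, hspan,
    finrank_span_singleton one_ne_zero]

/-- By Gershgorin's theorem, nonzero eigenvalues of a Laplacian have positive real part. -/
lemma laplacian_re_pos_of_mem_spectrum [DecidableEq n]
    (hrow : ∀ j, ∑ k, M j k = 0) (hoff : ∀ j k, j ≠ k → M j k ≤ 0) {μ : ℂ}
    (hμ : μ ∈ spectrum ℂ (M.map Complex.ofReal)) (hμ0 : μ ≠ 0) : 0 < μ.re := by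
  rw [← Matrix.spectrum_toLin', ← Module.End.hasEigenvalue_iff_mem_spectrum] at hμ
  obtain ⟨k, hk⟩ := eigenvalue_mem_ball hμ
  have hradius : ∑ j ∈ Finset.univ.erase k, ‖(M.map Complex.ofReal) k j‖ = M k k := by
    rw [eq_comm, ← sub_eq_zero, ← hrow k, ← Finset.add_sum_erase _ _ (Finset.mem_univ k),
      sub_eq_add_neg, ← Finset.sum_neg_distrib]
    congr 1
    refine Finset.sum_congr rfl fun j hj => ?_
    simp [abs_of_nonpos (hoff k j (Finset.ne_of_mem_erase hj).symm)]
  rw [hradius, mem_closedBall_iff_norm, Matrix.map_apply] at hk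
  have hM : 0 ≤ M k k := (norm_nonneg _).trans hk
  have hsq := pow_le_pow_left₀ (norm_nonneg _) hk 2
  rw [← Complex.normSq_eq_norm_sq, Complex.normSq_apply] at hsq
  simp only [Complex.sub_re, Complex.sub_im, Complex.ofReal_re, Complex.ofReal_im] at hsq
  have hpos := Complex.normSq_pos.2 hμ0
  rw [Complex.normSq_apply] at hpos
  by_contra! hre
  nlinarith [mul_nonneg hM (neg_nonneg.2 hre)]

end Laplacian

/-- Lemma 3 (Ren–Beard): for the Laplacian `M` of a nonnegatively weighted directed graph
(zero row sums, nonpositive off-diagonal entries), `0` is an eigenvalue of algebraic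
multiplicity exactly one and every nonzero eigenvalue has positive real part if and only
if the graph contains a directed spanning tree. -/
theorem laplacian_simple_zero_and_pos_re_iff_spanning_tree
    (l : ℕ) (M : Matrix (Fin l) (Fin l) ℝ)
    (hrow : ∀ j : Fin l, ∑ k : Fin l, M j k = 0)
    (hoff : ∀ j k : Fin l, j ≠ k → M j k ≤ 0) :
    (Polynomial.rootMultiplicity (0 : ℝ) M.charpoly = 1 ∧
      ∀ μ ∈ spectrum ℂ (M.map Complex.ofReal), μ ≠ 0 → 0 < μ.re) ↔
    ∃ r : Fin l, ∀ j : Fin l,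
      Relation.ReflTransGen (fun k j : Fin l => M j k < 0) r j := by
  constructor
  · rintro ⟨hmul, -⟩
    exact laplacian_exists_root_of_rootMultiplicity_eq_one hrow hoff hmul
  · rintro ⟨r, hr⟩
    exact ⟨laplacian_rootMultiplicity_eq_one_of_root hrow hoff hr,
      fun μ hμ hμ0 => laplacian_re_pos_of_mem_spectrum hrow hoff hμ hμ0⟩
end

section
/- Let L̂_c be the (L−N)×(L−N) block matrix with diagonal blocks c_i L̂_{ii} ∈ ℝ^{(l_i−1)×(l_i−1)} and off-diagonal blocks L̂_{ij}, write L̂_d = blockdiag{c_1 L̂_{11},…,c_N L̂_{NN}} and L̂_o = L̂_c − L̂_d. Suppose for each i there is a symmetric positive definite Ŵ_i ∈ ℝ^{(l_i−1)×(l_i−1)} such that Ŵ_i L̂_{ii} + L̂_{ii}ᵀ Ŵ_i is positive definite, set Ŵ = blockdiag{Ŵ_1,…,Ŵ_N}, and suppose each weighting factor satisfies c_i ≥ (λ_max(Ŵ) − λ_min(Ŵ L̂_o + L̂_oᵀ Ŵ)) / λ_min(Ŵ_i L̂_{ii} + L̂_{ii}ᵀ Ŵ_i). Then Ŵ L̂_c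 + L̂_cᵀ Ŵ ⪰ Ŵ in the Loewner order (i.e. Ŵ L̂_c + L̂_cᵀ Ŵ − Ŵ is positive semidefinite). -/
open Matrix

/-- Largest real eigenvalue (for symmetric matrices, `λ_max`). -/
noncomputable def maxEig {m : Type*} [Fintype m] [DecidableEq m]
    (M : Matrix m m ℝ) : ℝ :=
  sSup (spectrum ℝ M)

/-- Smallest real eigenvalue (for symmetric matrices, `λ_min`). -/
noncomputable def minEig {m : Type*} [Fintype m] [DecidableEq m]
    (M : Matrix m m ℝ) : ℝ :=
  sInf (spectrum ℝ M)

/-- The `(i,i)` diagonal block of a matrix on `Σ i, Fin (l i - 1)`. -/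
noncomputable def diagBlock {N : ℕ} {l : Fin N → ℕ}
    (M : Matrix ((i : Fin N) × Fin (l i - 1)) ((i : Fin N) × Fin (l i - 1)) ℝ)
    (i : Fin N) : Matrix (Fin (l i - 1)) (Fin (l i - 1)) ℝ :=
  Matrix.of fun p q => M ⟨i, p⟩ ⟨i, q⟩

namespace Matrix

variable {m : Type*} [Fintype m] [DecidableEq m] {M : Matrix m m ℝ}

/-- A Hermitian matrix minus a lower bound of its spectrum is positive semidefinite. -/
lemma IsHermitian.posSemidef_sub_smul_one (hM : M.IsHermitian) {a : ℝ}
    (ha : ∀ μ ∈ spectrum ℝ M, a ≤ μ) : (M - a • (1 : Matrix m m ℝ)).PosSemidef := by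
  have hH : (M - a • (1 : Matrix m m ℝ)).IsHermitian :=
    hM.sub (by simp [IsHermitian])
  rw [hH.posSemidef_iff_eigenvalues_nonneg]
  intro i
  have hmem := hH.eigenvalues_mem_spectrum_real i
  generalize hH.eigenvalues i = ν at hmem ⊢
  rw [← Algebra.algebraMap_eq_smul_one, ← spectrum.sub_singleton_eq] at hmem
  obtain ⟨μ, hμ, b, rfl, h⟩ := Set.mem_sub.mp hmem
  have := ha μ hμ
  simp only [Pi.zero_apply]
  linarith

lemma IsHermitian.posSemidef_sub_minEig (hM : M.IsHermitian) :
    (M - minEig M • (1 : Matrix m m ℝ)).PosSemidef :=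
  hM.posSemidef_sub_smul_one fun _ hμ => csInf_le finite_real_spectrum.bddBelow hμ

lemma IsHermitian.posSemidef_maxEig_sub (hM : M.IsHermitian) :
    (maxEig M • (1 : Matrix m m ℝ) - M).PosSemidef := by
  have h := hM.neg.posSemidef_sub_smul_one (a := -maxEig M) fun μ hμ => by
    rw [← spectrum.neg_eq, Set.mem_neg] at hμ
    exact neg_le.mp (le_csSup finite_real_spectrum.bddAbove hμ)
  rwa [neg_smul, sub_neg_eq_add, neg_add_eq_sub] at h

lemma PosDef.minEig_pos [Nonempty m] (hM : M.PosDef) : 0 < minEig M := by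
  have hne : (spectrum ℝ M).Nonempty :=
    ⟨_, hM.isHermitian.eigenvalues_mem_spectrum_real (Classical.arbitrary m)⟩
  have hmem : minEig M ∈ spectrum ℝ M := hne.csInf_mem finite_real_spectrum
  rw [hM.isHermitian.spectrum_real_eq_range_eigenvalues] at hmem
  obtain ⟨i, hi⟩ := hmem
  rw [← hi]
  exact hM.eigenvalues_pos i

/-- If `κ / λ_min(M) ≤ c` then `c M ⪰ κ I`. -/
lemma PosDef.posSemidef_smul_sub_smul_one (hM : M.PosDef) {c κ : ℝ} (hc : 0 ≤ c)
    (h : κ / minEig M ≤ c) : (c • M - κ • (1 : Matrix m m ℝ)).PosSemidef := by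
  cases isEmpty_or_nonempty m
  · rw [Subsingleton.elim (c • M - κ • (1 : Matrix m m ℝ)) 0]
    exact PosSemidef.zero
  · have hκ : 0 ≤ c * minEig M - κ := sub_nonneg.mpr ((div_le_iff₀ hM.minEig_pos).mp h)
    have hsum := (hM.isHermitian.posSemidef_sub_minEig.smul hc).add
      (PosSemidef.one (n := m) (R := ℝ) |>.smul hκ)
    convert hsum using 1
    module

open scoped MatrixOrder in
lemma PosSemidef.blockDiagonal' {ι : Type*} [Fintype ι] [DecidableEq ι] {n : ι → Type*}
    [∀ i, Fintype (n i)] [∀ i, DecidableEq (n i)] {A : ∀ i, Matrix (n i) (n i) ℝ}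
    (hA : ∀ i, (A i).PosSemidef) : (Matrix.blockDiagonal' A).PosSemidef := by
  choose B hB using fun i => CStarAlgebra.nonneg_iff_eq_star_mul_self.mp (hA i).nonneg
  simp only [funext hB, star_eq_conjTranspose]
  rw [blockDiagonal'_mul, ← blockDiagonal'_conjTranspose]
  exact posSemidef_conjTranspose_mul_self _

end Matrix

/-- If each `Ŵ_i` is symmetric positive definite with `Ŵ_i L̂_{ii} + L̂_{ii}ᵀ Ŵ_i` positive
definite, `Ŵ = blockdiag{Ŵ_1,…,Ŵ_N}`, and every weighting factor satisfies
`c_i ≥ (λ_max(Ŵ) - λ_min(Ŵ L̂_o + L̂_oᵀ Ŵ)) / λ_min(Ŵ_i L̂_{ii} + L̂_{ii}ᵀ Ŵ_i)`,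
then `Ŵ L̂_c + L̂_cᵀ Ŵ ⪰ Ŵ` in the Loewner order. -/
theorem loewner_bound_of_local_weights
    (N : ℕ) (l : Fin N → ℕ)
    (Lhat : Matrix ((i : Fin N) × Fin (l i - 1)) ((i : Fin N) × Fin (l i - 1)) ℝ)
    (c : Fin N → ℝ) (hc : ∀ i, 0 < c i)
    (What : Matrix ((i : Fin N) × Fin (l i - 1)) ((i : Fin N) × Fin (l i - 1)) ℝ)
    (hWblock : ∀ p q : (i : Fin N) × Fin (l i - 1), p.1 ≠ q.1 → What p q = 0)
    (hWpd : ∀ i : Fin N, (diagBlock What i).PosDef)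
    (hWLpd : ∀ i : Fin N,
      (diagBlock What i * diagBlock Lhat i +
        (diagBlock Lhat i)ᵀ * diagBlock What i).PosDef)
    (hci : ∀ i : Fin N,
      (maxEig What -
          minEig (What *
              (Matrix.of fun p q : (i : Fin N) × Fin (l i - 1) =>
                if p.1 = q.1 then 0 else Lhat p q) +
            (Matrix.of fun p q : (i : Fin N) × Fin (l i - 1) =>
                if p.1 = q.1 then 0 else Lhat p q)ᵀ * What)) /
        minEig (diagBlock What i * diagBlock Lhat i +
          (diagBlock Lhat i)ᵀ * diagBlock What i) ≤ c i) :
    (What * (Matrix.of fun p q : (i : Fin N) × Fin (l i - 1) =>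
        (if p.1 = q.1 then c p.1 else 1) * Lhat p q) +
      (Matrix.of fun p q : (i : Fin N) × Fin (l i - 1) =>
        (if p.1 = q.1 then c p.1 else 1) * Lhat p q)ᵀ * What -
      What).PosSemidef := by
  set Lo : Matrix ((i : Fin N) × Fin (l i - 1)) ((i : Fin N) × Fin (l i - 1)) ℝ :=
    Matrix.of fun p q => if p.1 = q.1 then 0 else Lhat p q with hLo
  set κ := maxEig What - minEig (What * Lo + Loᵀ * What) with hκ
  have hW : What = blockDiagonal' (diagBlock What) := by
    ext ⟨i, p⟩ ⟨j, q⟩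
    by_cases hij : i = j
    · subst hij
      simp [diagBlock]
    · rw [blockDiagonal'_apply_ne _ _ _ hij, hWblock _ _ hij]
  have hL : (Matrix.of fun p q : (i : Fin N) × Fin (l i - 1) =>
      (if p.1 = q.1 then c p.1 else 1) * Lhat p q) =
        blockDiagonal' (fun i => c i • diagBlock Lhat i) + Lo := by
    ext ⟨i, p⟩ ⟨j, q⟩
    by_cases hij : i = j
    · subst hij
      simp [diagBlock, hLo]
    · simp [blockDiagonal'_apply_ne _ _ _ hij, hLo, hij]
  have hWherm : What.IsHermitian := by
    rw [hW, IsHermitian, blockDiagonal'_conjTranspose]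
    exact congrArg _ (funext fun i => (hWpd i).isHermitian)
  have hOherm : (What * Lo + Loᵀ * What).IsHermitian := by
    have hT : Whatᵀ = What := hWherm
    rw [IsHermitian, conjTranspose_eq_transpose_of_trivial, transpose_add, transpose_mul,
      transpose_mul, transpose_transpose, hT, add_comm]
  have hD : What * blockDiagonal' (fun i => c i • diagBlock Lhat i) +
      (blockDiagonal' fun i => c i • diagBlock Lhat i)ᵀ * What - κ • 1 =
        blockDiagonal' fun i => c i • (diagBlock What i * diagBlock Lhat i +
          (diagBlock Lhat i)ᵀ * diagBlock What i) - κ • 1 := by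
    conv_lhs => rw [hW]
    rw [blockDiagonal'_transpose, ← blockDiagonal'_mul, ← blockDiagonal'_mul,
      ← blockDiagonal'_add, ← blockDiagonal'_one, ← blockDiagonal'_smul, ← blockDiagonal'_sub]
    congr 1
    funext i
    simp [smul_add]
  have hDpsd := PosSemidef.blockDiagonal' fun i =>
    (hWLpd i).posSemidef_smul_sub_smul_one (hc i).le (hci i)
  rw [← hD] at hDpsd
  rw [hL]
  convert (hDpsd.add hOherm.posSemidef_sub_minEig).add hWherm.posSemidef_maxEig_sub using 1
  rw [hκ, transpose_add, mul_add, add_mul]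
  module
end

section
/- Consider the multi-agent system of N clusters with the dynamic coupling law and gains K_i = −B_iᵀP_i with P_i symmetric positive definite solving P_iA_i + A_iᵀP_i − P_iB_iB_iᵀP_i = −I. Assume: every block L_{ij} of the graph Laplacian has zero row sums; each A_i has at least one eigenvalue with nonnegative real part; the partition is acyclic, i.e. L_{ij} = 0 for all j > i; and each subgraph G_i is nonnegatively weighted (a_{lk} ≥ 0 for l,k ∈ C_i). Then the matrix Â − c L̂_c ⊗ I_n is Hurwitz (equivalently, by Theorem 1, the system achieves N-cluster synchronization) if and only if every subgraph G_i contains a directed spanning tree (there exists r ∈ C_i from which every l ∈ C_i is reachable along edges within C_i with a_{lk} > 0) and the weighting factors satisfy c·c_i > max{Re α : α ∈ σ(A_i)} / min{Re β : β ∈ σ(L̂_{ii})} for every i = 1,…,N. -/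
open Matrix

open scoped Kronecker

lemma Matrix.mem_spectrum_iff_det {ι : Type*} [Fintype ι] [DecidableEq ι] {M : Matrix ι ι ℂ}
    {μ : ℂ} : μ ∈ spectrum ℂ M ↔ (algebraMap ℂ (Matrix ι ι ℂ) μ - M).det = 0 := by
  rw [spectrum.mem_iff, Matrix.isUnit_iff_isUnit_det, isUnit_iff_ne_zero, not_not]

lemma Matrix.mem_spectrum_iff_exists_mulVec {ι : Type*} [Fintype ι] [DecidableEq ι]
    {M : Matrix ι ι ℂ} {μ : ℂ} : μ ∈ spectrum ℂ M ↔ ∃ v, v ≠ 0 ∧ M *ᵥ v = μ • v := by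
  rw [Matrix.mem_spectrum_iff_det, ← Matrix.exists_mulVec_eq_zero_iff]
  refine exists_congr fun v => and_congr_right fun _ => ?_
  rw [Matrix.sub_mulVec, sub_eq_zero, Algebra.algebraMap_eq_smul_one, Matrix.smul_mulVec,
    Matrix.one_mulVec, eq_comm]

lemma zero_mem_spectrum_map_ofReal_iff {ι : Type*} [Fintype ι] [DecidableEq ι]
    {M : Matrix ι ι ℝ} : (0 : ℂ) ∈ spectrum ℂ (M.map Complex.ofReal) ↔ M.det = 0 := by
  rw [spectrum.zero_mem_iff, Matrix.isUnit_iff_isUnit_det, isUnit_iff_ne_zero, not_not]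
  have := Complex.ofRealHom.map_det M
  rw [RingHom.mapMatrix_apply] at this
  change (M.map Complex.ofRealHom).det = 0 ↔ _
  rw [← this]
  simp

/-- The spectrum of a block triangular matrix is the union of the spectra of its diagonal
blocks. -/
lemma Matrix.BlockTriangular.mem_spectrum_iff {ι α : Type*} [Fintype ι] [DecidableEq ι]
    [Fintype α] [LinearOrder α] {M : Matrix ι ι ℂ} {f : ι → α} (hM : M.BlockTriangular f) {μ : ℂ} :
    μ ∈ spectrum ℂ M ↔ ∃ i, μ ∈ spectrum ℂ (M.toSquareBlock f i) := by
  have hT : (algebraMap ℂ (Matrix ι ι ℂ) μ - M).BlockTriangular f :=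
    BlockTriangular.sub (fun p q hqp => by
      rw [Matrix.algebraMap_matrix_apply, if_neg]
      rintro rfl
      exact lt_irrefl _ hqp) hM
  rw [Matrix.mem_spectrum_iff_det, hT.det_fintype, Finset.prod_eq_zero_iff]
  simp only [Finset.mem_univ, true_and]
  refine exists_congr fun i => ?_
  rw [Matrix.mem_spectrum_iff_det]
  have : (algebraMap ℂ (Matrix ι ι ℂ) μ - M).toSquareBlock f i
      = algebraMap ℂ _ μ - M.toSquareBlock f i := by
    ext p q
    simp [Matrix.toSquareBlock_def, Matrix.algebraMap_matrix_apply, Subtype.ext_iff]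
  rw [this]

/-- Commuting matrices `F`, `G`: an eigenvalue of `F - G` is a difference of eigenvalues with a
common eigenvector. -/
lemma Matrix.exists_common_eigenvector_of_commute {ι : Type*} [Fintype ι] [DecidableEq ι]
    {F G : Matrix ι ι ℂ} (hFG : Commute F G) {μ : ℂ} (hμ : μ ∈ spectrum ℂ (F - G)) :
    ∃ α, ∃ v, v ≠ 0 ∧ F *ᵥ v = α • v ∧ G *ᵥ v = (α - μ) • v := by
  let E := Module.End.eigenspace (Matrix.toLin' (F - G)) μ
  have hmaps : ∀ v ∈ E, Matrix.toLin' F v ∈ E := by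
    intro v hv
    rw [Module.End.mem_eigenspace_iff, Matrix.toLin'_apply] at hv ⊢
    have hcomm : (F - G) * F = F * (F - G) := by rw [sub_mul, mul_sub, hFG.eq]
    rw [Matrix.toLin'_apply, Matrix.mulVec_mulVec, hcomm, ← Matrix.mulVec_mulVec, hv,
      Matrix.mulVec_smul]
  obtain ⟨w, hw0, hw⟩ := Matrix.mem_spectrum_iff_exists_mulVec.1 hμ
  have : Nontrivial E := ⟨⟨⟨w, Module.End.mem_eigenspace_iff.2 hw⟩, 0,
    fun h => hw0 (congrArg Subtype.val h)⟩⟩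
  obtain ⟨α, hα⟩ := Module.End.exists_eigenvalue ((Matrix.toLin' F).restrict hmaps)
  obtain ⟨⟨v, hvE⟩, hv, hv0⟩ := hα.exists_hasEigenvector
  have hF : F *ᵥ v = α • v := congrArg Subtype.val (Module.End.mem_eigenspace_iff.1 hv)
  have hE : (F - G) *ᵥ v = μ • v := Module.End.mem_eigenspace_iff.1 hvE
  refine ⟨α, v, fun h => hv0 (Subtype.ext h), hF, ?_⟩
  rw [Matrix.sub_mulVec, hF] at hE
  rw [sub_smul, ← hE, sub_sub_cancel]

lemma Matrix.one_kronecker_mulVec_apply {ι κ : Type*} [Fintype ι] [DecidableEq ι] [Fintype κ]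
    (A : Matrix κ κ ℂ) (v : ι × κ → ℂ) (p : ι) (x : κ) :
    (((1 : Matrix ι ι ℂ) ⊗ₖ A) *ᵥ v) (p, x) = (A *ᵥ fun y => v (p, y)) x := by
  simp [Matrix.mulVec, dotProduct, Fintype.sum_prod_type, Matrix.one_apply, Finset.sum_ite_eq]

lemma Matrix.kronecker_one_mulVec_apply {ι κ : Type*} [Fintype ι] [Fintype κ] [DecidableEq κ]
    (L : Matrix ι ι ℂ) (v : ι × κ → ℂ) (p : ι) (x : κ) :
    ((L ⊗ₖ (1 : Matrix κ κ ℂ)) *ᵥ v) (p, x) = (L *ᵥ fun q => v (q, x)) p := by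
  simp [Matrix.mulVec, dotProduct, Fintype.sum_prod_type, Matrix.one_apply, Finset.sum_ite_eq]

/-- The eigenvalues of `I ⊗ A - t (L ⊗ I)` are the numbers `α - t β` with `α` an eigenvalue of `A`
and `β` an eigenvalue of `L`. -/
lemma Matrix.mem_spectrum_kronecker_sub_iff {ι κ : Type*} [Fintype ι] [DecidableEq ι] [Fintype κ]
    [DecidableEq κ] (A : Matrix κ κ ℂ) (L : Matrix ι ι ℂ) {t : ℂ} (ht : t ≠ 0) {μ : ℂ} :
    μ ∈ spectrum ℂ ((1 : Matrix ι ι ℂ) ⊗ₖ A - t • (L ⊗ₖ (1 : Matrix κ κ ℂ))) ↔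
      ∃ α ∈ spectrum ℂ A, ∃ β ∈ spectrum ℂ L, μ = α - t * β := by
  constructor
  · intro hμ
    have hcomm : Commute ((1 : Matrix ι ι ℂ) ⊗ₖ A) (t • (L ⊗ₖ (1 : Matrix κ κ ℂ))) := by
      refine Commute.smul_right ?_ t
      rw [Commute, SemiconjBy, ← Matrix.mul_kronecker_mul, ← Matrix.mul_kronecker_mul]
      simp
    obtain ⟨α, v, hv0, hF, hG⟩ := Matrix.exists_common_eigenvector_of_commute hcomm hμ
    obtain ⟨⟨p, x⟩, hpx⟩ := Function.ne_iff.1 hv0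
    refine ⟨α, Matrix.mem_spectrum_iff_exists_mulVec.2 ⟨fun y => v (p, y), ?_, ?_⟩,
      (α - μ) / t, Matrix.mem_spectrum_iff_exists_mulVec.2 ⟨fun q => v (q, x), ?_, ?_⟩, ?_⟩
    · exact fun h => hpx (congrFun h x)
    · funext y
      rw [← Matrix.one_kronecker_mulVec_apply, hF]
      simp
    · exact fun h => hpx (congrFun h p)
    · funext q
      rw [← Matrix.kronecker_one_mulVec_apply]
      have := congrFun hG (q, x)
      rw [Matrix.smul_mulVec, Pi.smul_apply, Pi.smul_apply, smul_eq_mul, smul_eq_mul] at this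
      rw [Pi.smul_apply, smul_eq_mul, div_mul_eq_mul_div, eq_div_iff ht, ← this, mul_comm]
    · field_simp
      ring
  · rintro ⟨α, hα, β, hβ, rfl⟩
    obtain ⟨v, hv0, hv⟩ := Matrix.mem_spectrum_iff_exists_mulVec.1 hα
    obtain ⟨w, hw0, hw⟩ := Matrix.mem_spectrum_iff_exists_mulVec.1 hβ
    obtain ⟨x, hx⟩ := Function.ne_iff.1 hv0
    obtain ⟨p, hp⟩ := Function.ne_iff.1 hw0
    refine Matrix.mem_spectrum_iff_exists_mulVec.2 ⟨fun z => w z.1 * v z.2, fun h => ?_, ?_⟩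
    · exact mul_ne_zero hp hx (congrFun h (p, x))
    · funext ⟨q, y⟩
      have h1 : (A *ᵥ fun z => w q * v z) y = w q * (α * v y) := by
        rw [show (fun z => w q * v z) = w q • v from rfl, Matrix.mulVec_smul, hv]
        simp
      have h2 : (L *ᵥ fun z => w z * v y) q = v y * (β * w q) := by
        rw [show (fun z => w z * v y) = v y • w from funext fun z => mul_comm _ _,
          Matrix.mulVec_smul, hw]
        simp
      rw [Matrix.sub_mulVec, Pi.sub_apply, Matrix.one_kronecker_mulVec_apply, Matrix.smul_mulVec,
        Pi.smul_apply, Matrix.kronecker_one_mulVec_apply, h1, h2]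
      simp only [smul_eq_mul, Pi.smul_apply]
      ring

/-- The reduced matrix of a matrix indexed by `Fin (k + 1)`: subtract the first row from the others
and delete the first row and column. -/
def firstRowReduction {R : Type*} [Ring R] {k : ℕ} (L : Matrix (Fin (k + 1)) (Fin (k + 1)) R) :
    Matrix (Fin k) (Fin k) R :=
  Matrix.of fun p q => L p.succ q.succ - L 0 q.succ

lemma firstRowReduction_mulVec {R : Type*} [Ring R] {k : ℕ}
    (L : Matrix (Fin (k + 1)) (Fin (k + 1)) R) (y : Fin k → R) (p : Fin k) :
    (firstRowReduction L *ᵥ y) p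
      = (L *ᵥ (Fin.cons 0 y : Fin (k + 1) → R)) p.succ
        - (L *ᵥ (Fin.cons 0 y : Fin (k + 1) → R)) 0 := by
  simp [firstRowReduction, Matrix.mulVec, dotProduct, Fin.sum_univ_succ, sub_mul,
    Finset.sum_sub_distrib]

/-- A Laplacian of a nonnegatively weighted digraph: nonpositive off-diagonal entries and zero
row sums. -/
structure IsLaplacian {ι : Type*} [Fintype ι] (L : Matrix ι ι ℝ) : Prop where
  offDiag_nonpos : ∀ p q, p ≠ q → L p q ≤ 0
  row_sum : ∀ p, ∑ q, L p q = 0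

namespace IsLaplacian

variable {ι : Type*} [Fintype ι] {L : Matrix ι ι ℝ}

lemma mulVec_apply (hL : IsLaplacian L) (x : ι → ℝ) (p : ι) :
    (L *ᵥ x) p = ∑ q, L p q * (x q - x p) := by
  simp [Matrix.mulVec, dotProduct, mul_sub, Finset.sum_sub_distrib, ← Finset.sum_mul,
    hL.row_sum p]

lemma term_nonneg (hL : IsLaplacian L) {S : Set ι} (hS : ∀ p ∈ S, ∀ q ∉ S, L p q = 0)
    {x : ι → ℝ} {p : ι} (hp : p ∈ S) (hmax : ∀ q ∈ S, x q ≤ x p) (q : ι) :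
    0 ≤ L p q * (x q - x p) := by
  by_cases hqS : q ∈ S
  · by_cases hpq : p = q
    · simp [hpq]
    · exact mul_nonneg_of_nonpos_of_nonpos (hL.offDiag_nonpos p q hpq)
        (sub_nonpos.2 (hmax q hqS))
  · simp [hS p hp q hqS]

lemma nonneg_of_mulVec_eq_const_on (hL : IsLaplacian L) {S : Set ι} (hne : S.Nonempty)
    (hS : ∀ p ∈ S, ∀ q ∉ S, L p q = 0) {x : ι → ℝ} {s : ℝ} (hx : ∀ p ∈ S, (L *ᵥ x) p = s) :
    0 ≤ s := by
  obtain ⟨p, hp, hmax⟩ := S.toFinite.exists_maximalFor x S hne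
  have hmax' : ∀ q ∈ S, x q ≤ x p := fun q hq => (le_total (x q) (x p)).elim id (hmax hq)
  rw [← hx p hp, hL.mulVec_apply]
  exact Finset.sum_nonneg fun q _ => hL.term_nonneg hS hp hmax' q

/-- On a nonempty set of vertices closed under in-neighbours, a Laplacian takes no nonzero
constant value. -/
lemma eq_zero_of_mulVec_eq_const_on (hL : IsLaplacian L) {S : Set ι} (hne : S.Nonempty)
    (hS : ∀ p ∈ S, ∀ q ∉ S, L p q = 0) {x : ι → ℝ} {s : ℝ} (hx : ∀ p ∈ S, (L *ᵥ x) p = s) :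
    s = 0 := by
  refine le_antisymm ?_ (hL.nonneg_of_mulVec_eq_const_on hne hS hx)
  have := hL.nonneg_of_mulVec_eq_const_on hne hS (x := -x) (s := -s)
    fun p hp => by rw [Matrix.mulVec_neg, Pi.neg_apply, hx p hp]
  linarith

/-- A vector in the kernel of a Laplacian attains its maximum at every root. -/
lemma le_root_of_mulVec_eq_zero (hL : IsLaplacian L) {x : ι → ℝ} (hx : L *ᵥ x = 0) {r : ι}
    (hr : ∀ p, Relation.ReflTransGen (fun k j => L j k < 0) r p) (q : ι) : x q ≤ x r := by
  have : Nonempty ι := ⟨r⟩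
  obtain ⟨p, hp⟩ := Finite.exists_max x
  suffices h : ∀ q, x r < x q → x q ≠ x p by
    by_contra! hq
    exact h p (hq.trans_le (hp q)) rfl
  intro q
  induction hr q with
  | refl => exact fun h => absurd h (lt_irrefl _)
  | @tail k j _ hkj ih =>
    intro hlt heq
    have hj : ∀ u, x u ≤ x j := fun u => heq ▸ hp u
    have hsum := hL.mulVec_apply x j
    rw [hx, Pi.zero_apply, eq_comm, Finset.sum_eq_zero_iff_of_nonneg fun u _ =>
      hL.term_nonneg (S := Set.univ) (by simp) (Set.mem_univ j) (fun u _ => hj u) u] at hsum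
    have hk : x k = x j := by
      have := (mul_eq_zero.1 (hsum k (Finset.mem_univ k))).resolve_left hkj.ne
      linarith
    exact ih (hk ▸ hlt) (hk.trans heq)

lemma eq_of_mulVec_eq_zero (hL : IsLaplacian L) {x : ι → ℝ} (hx : L *ᵥ x = 0) {r : ι}
    (hr : ∀ p, Relation.ReflTransGen (fun k j => L j k < 0) r p) (q : ι) : x q = x r := by
  refine le_antisymm (hL.le_root_of_mulVec_eq_zero hx hr q) ?_
  have := hL.le_root_of_mulVec_eq_zero (x := -x) (by rw [Matrix.mulVec_neg, hx, neg_zero]) hr q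
  simpa using this

lemma re_pos_of_hasEigenvalue [DecidableEq ι] (hL : IsLaplacian L) {β : ℂ} (hβ : β ≠ 0)
    {v : ι → ℂ} (hv : v ≠ 0) (h : L.map Complex.ofReal *ᵥ v = β • v) : 0 < β.re := by
  obtain ⟨p, hp⟩ := eigenvalue_mem_ball (A := L.map Complex.ofReal) (μ := β)
    (Module.End.hasEigenvalue_of_hasEigenvector
      (Module.End.hasEigenvector_iff.2 ⟨Module.End.mem_eigenspace_iff.2 h, hv⟩))
  have hsum : ∑ q ∈ Finset.univ.erase p, ‖L.map Complex.ofReal p q‖ = L p p := by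
    have h1 : ∀ q ∈ Finset.univ.erase p, ‖L.map Complex.ofReal p q‖ = -L p q := fun q hq => by
      simp [abs_of_nonpos (hL.offDiag_nonpos p q (Finset.ne_of_mem_erase hq).symm)]
    rw [Finset.sum_congr rfl h1, Finset.sum_neg_distrib,
      Finset.sum_erase_eq_sub (Finset.mem_univ p), hL.row_sum]
    ring
  rw [hsum, mem_closedBall_iff_norm, Matrix.map_apply] at hp
  have hsq := pow_le_pow_left₀ (norm_nonneg _) hp 2
  rw [← Complex.normSq_eq_norm_sq, Complex.normSq_apply] at hsq
  simp only [Complex.sub_re, Complex.ofReal_re, Complex.sub_im, Complex.ofReal_im] at hsq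
  have hpos := Complex.normSq_pos.2 hβ
  rw [Complex.normSq_apply] at hpos
  have hd : 0 ≤ L p p := (norm_nonneg _).trans hp
  by_contra! hre
  nlinarith [mul_nonneg hd (neg_nonneg.2 hre)]

end IsLaplacian

namespace IsLaplacian

variable {k : ℕ} {L : Matrix (Fin (k + 1)) (Fin (k + 1)) ℝ}

/-- If some vertex reaches all others, the reduced Laplacian is nonsingular. -/
lemma det_firstRowReduction_ne_zero (hL : IsLaplacian L)
    (hroot : ∃ r, ∀ p, Relation.ReflTransGen (fun k j => L j k < 0) r p) :
    (firstRowReduction L).det ≠ 0 := by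
  obtain ⟨r, hr⟩ := hroot
  intro hdet
  obtain ⟨y, hy0, hy⟩ := Matrix.exists_mulVec_eq_zero_iff.2 hdet
  set x : Fin (k + 1) → ℝ := Fin.cons 0 y with hx
  have hconst : ∀ p, (L *ᵥ x) p = (L *ᵥ x) 0 := by
    refine Fin.cases rfl fun p => ?_
    have := firstRowReduction_mulVec L y p
    rw [hy, Pi.zero_apply] at this
    exact (sub_eq_zero.1 this.symm)
  have h0 : (L *ᵥ x) 0 = 0 := hL.eq_zero_of_mulVec_eq_const_on (S := Set.univ)
    Set.univ_nonempty (by simp) fun p _ => hconst p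
  have hker : L *ᵥ x = 0 := funext fun p => (hconst p).trans h0
  refine hy0 (funext fun p => ?_)
  have := (hL.eq_of_mulVec_eq_zero hker hr p.succ).trans
    (hL.eq_of_mulVec_eq_zero hker hr 0).symm
  simpa [hx] using this

/-- If the reduced Laplacian is nonsingular, some vertex reaches all others. -/
lemma exists_root_of_det_firstRowReduction_ne_zero (hL : IsLaplacian L)
    (hdet : (firstRowReduction L).det ≠ 0) :
    ∃ r, ∀ p, Relation.ReflTransGen (fun k j => L j k < 0) r p := by
  let reach : Fin (k + 1) → Fin (k + 1) → Prop := Relation.ReflTransGen fun k j => L j k < 0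
  have hclosed : ∀ u, ∀ p ∈ {p | reach p u}, ∀ q ∉ {p | reach p u}, L p q = 0 := by
    intro u p hp q hq
    by_contra h
    have hne : p ≠ q := by rintro rfl; exact hq hp
    exact hq (Relation.ReflTransGen.head (lt_of_le_of_ne (hL.offDiag_nonpos p q hne) h) hp)
  have hdir : Directed (fun p q => reach q p) (id : Fin (k + 1) → Fin (k + 1)) := by
    intro p q
    by_contra! hno
    classical
    let e : Fin (k + 1) → ℝ := fun u => if reach u p then 1 else 0
    let y : Fin k → ℝ := (firstRowReduction L)⁻¹ *ᵥ fun u => e u.succ - e 0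
    have hy : firstRowReduction L *ᵥ y = fun u => e u.succ - e 0 := by
      rw [Matrix.mulVec_mulVec, Matrix.mul_nonsing_inv _ (isUnit_iff_ne_zero.2 hdet),
        Matrix.one_mulVec]
    set x : Fin (k + 1) → ℝ := Fin.cons 0 y
    have hval : ∀ u, (L *ᵥ x) u = e u + ((L *ᵥ x) 0 - e 0) := by
      refine Fin.cases (by ring) fun u => ?_
      have := firstRowReduction_mulVec L y u
      rw [hy] at this
      change e u.succ - e 0 = (L *ᵥ x) u.succ - (L *ᵥ x) 0 at this
      linarith
    have hp := hL.eq_zero_of_mulVec_eq_const_on (S := {u | reach u p}) (x := x)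
      ⟨p, Relation.ReflTransGen.refl⟩ (hclosed p) (s := 1 + ((L *ᵥ x) 0 - e 0)) fun u hu => by
        rw [hval u, show e u = 1 from if_pos hu]
    have hq := hL.eq_zero_of_mulVec_eq_const_on (S := {u | reach u q}) (x := x)
      ⟨q, Relation.ReflTransGen.refl⟩ (hclosed q) (s := 0 + ((L *ᵥ x) 0 - e 0)) fun u hu => by
        rw [hval u, show e u = 0 from if_neg fun h => hno u h hu]
    linarith
  have : IsTrans (Fin (k + 1)) fun p q => reach q p := ⟨fun _ _ _ h₁ h₂ => h₂.trans h₁⟩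
  exact hdir.finite_le id

/-- Every eigenvalue of the reduced Laplacian of a digraph with a root has positive real part. -/
lemma re_pos_of_mem_spectrum_firstRowReduction (hL : IsLaplacian L)
    (hdet : (firstRowReduction L).det ≠ 0) {β : ℂ}
    (hβ : β ∈ spectrum ℂ ((firstRowReduction L).map Complex.ofReal)) : 0 < β.re := by
  have hβ0 : β ≠ 0 := by
    rintro rfl
    rw [zero_mem_spectrum_map_ofReal_iff] at hβ
    exact hdet hβ
  obtain ⟨y, hy0, hy⟩ := Matrix.mem_spectrum_iff_exists_mulVec.1 hβ
  set x : Fin (k + 1) → ℂ := Fin.cons 0 y with hx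
  set s : ℂ := (L.map Complex.ofReal *ᵥ x) 0 with hs
  have hval : ∀ p, (L.map Complex.ofReal *ᵥ x) p = β * x p + s := by
    refine Fin.cases (by simp [hx, hs]) fun p => ?_
    have := firstRowReduction_mulVec (L.map Complex.ofReal) y p
    rw [show firstRowReduction (L.map Complex.ofReal) = (firstRowReduction L).map Complex.ofReal by
      ext; simp [firstRowReduction], hy, Pi.smul_apply, smul_eq_mul] at this
    rw [eq_add_of_sub_eq this.symm]
    simp [hx, hs]
  have hone : ∀ p, (L.map Complex.ofReal *ᵥ fun _ => s / β) p = 0 := fun p => by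
    have := congrArg Complex.ofReal (hL.row_sum p)
    push_cast at this
    simp [Matrix.mulVec, dotProduct, ← Finset.sum_mul, this]
  refine hL.re_pos_of_hasEigenvalue hβ0 (v := x + fun _ => s / β) (fun h0 => hy0 ?_) ?_
  · have h00 := congrFun h0 0
    funext p
    have hp := congrFun h0 p.succ
    simp only [hx, Pi.add_apply, Fin.cons_zero, Fin.cons_succ, Pi.zero_apply] at h00 hp
    rw [zero_add] at h00
    rwa [h00, add_zero] at hp
  · funext p
    rw [Matrix.mulVec_add, Pi.add_apply, hval, hone]
    simp only [Pi.smul_apply, Pi.add_apply, smul_eq_mul]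
    field_simp
    ring

end IsLaplacian

lemma mem_spectrum_clusterMatrix_iff (n N : ℕ) (l : Fin N → ℕ)
    (A : Fin N → Matrix (Fin n) (Fin n) ℝ)
    (b : ((i : Fin N) × Fin (l i)) → ((i : Fin N) × Fin (l i)) → ℝ)
    (hacyclic : ∀ (i j : Fin N), i < j → ∀ (p : Fin (l i)) (q : Fin (l j)),
      b ⟨i, p⟩ ⟨j, q⟩ = 0)
    (c : ℝ) (hc : 0 < c) (ci : Fin N → ℝ) (hci : ∀ i, 0 < ci i) {μ : ℂ} :
    μ ∈ spectrum ℂ ((clusterMatrix n N l c ci A b).map Complex.ofReal) ↔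
      ∃ i, ∃ α ∈ spectrum ℂ ((A i).map Complex.ofReal),
        ∃ β ∈ spectrum ℂ ((diagBlock (reducedLap N l b) i).map Complex.ofReal),
          μ = α - ((c * ci i : ℝ) : ℂ) * β := by
  let f : ((i : Fin N) × Fin (l i - 1)) × Fin n → (Fin N)ᵒᵈ := fun p => OrderDual.toDual p.1.1
  have hT : ((clusterMatrix n N l c ci A b).map Complex.ofReal).BlockTriangular f := by
    rintro ⟨⟨i, p⟩, x⟩ ⟨⟨j, q⟩, y⟩ hlt
    have hij : i < j := hlt
    have hne : ¬ (⟨i, p⟩ : (i : Fin N) × Fin (l i - 1)) = ⟨j, q⟩ :=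
      fun h => hij.ne (congrArg Sigma.fst h)
    simp [clusterMatrix, hatA, reducedLapWeighted, reducedLap, hacyclic i j hij, hne]
  rw [hT.mem_spectrum_iff, (OrderDual.toDual (α := Fin N)).surjective.exists]
  refine exists_congr fun i => ?_
  let e : Fin (l i - 1) × Fin n ≃ {p // f p = OrderDual.toDual i} :=
    Equiv.ofBijective (fun z => ⟨(⟨i, z.1⟩, z.2), rfl⟩) <| by
      constructor
      · rintro ⟨p, x⟩ ⟨q, y⟩ h
        simpa using h
      · rintro ⟨⟨⟨j, p⟩, x⟩, h⟩
        obtain rfl : j = i := h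
        exact ⟨(p, x), rfl⟩
  have ht : ((c * ci i : ℝ) : ℂ) ≠ 0 := by exact_mod_cast (mul_pos hc (hci i)).ne'
  rw [← Matrix.mem_spectrum_kronecker_sub_iff _ _ ht,
    ← AlgEquiv.spectrum_eq (Matrix.reindexAlgEquiv ℂ ℂ e.symm)]
  refine iff_of_eq (congrArg (fun M => μ ∈ spectrum ℂ M) ?_)
  ext ⟨p, x⟩ ⟨q, y⟩
  simp only [Matrix.coe_reindexAlgEquiv, Matrix.reindex_apply, Matrix.submatrix_apply,
    Equiv.symm_symm, Matrix.toSquareBlock_def, Matrix.of_apply, Matrix.map_apply,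
    Matrix.sub_apply, Matrix.smul_apply, Matrix.kroneckerMap_apply, smul_eq_mul]
  change ((clusterMatrix n N l c ci A b (⟨i, p⟩, x) (⟨i, q⟩, y) : ℝ) : ℂ) = _
  by_cases hpq : p = q <;> by_cases hxy : x = y <;>
    simp [clusterMatrix, hatA, reducedLapWeighted, diagBlock, Matrix.one_apply, hpq, hxy, mul_assoc]

/-- For finite sets, with `T` in the open right half plane, the pairwise comparison
`Re α < t Re β` amounts to a comparison of `max Re S / min Re T` with `t`. -/
lemma sSup_re_div_sInf_re_lt_iff {S T : Set ℂ} (hS : S.Finite) (hT : T.Finite)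
    (hSne : S.Nonempty) (hT0 : ∀ β ∈ T, 0 < β.re) {t : ℝ} (ht : 0 < t) :
    sSup (Complex.re '' S) / sInf (Complex.re '' T) < t ↔
      ∀ α ∈ S, ∀ β ∈ T, α.re < t * β.re := by
  have hSf := hS.image Complex.re
  have hTf := hT.image Complex.re
  rcases T.eq_empty_or_nonempty with rfl | hTne
  · simpa using ht
  obtain ⟨α₁, hα₁, hsup⟩ := (hSne.image Complex.re).csSup_mem hSf
  obtain ⟨β₁, hβ₁, hinf⟩ := (hTne.image Complex.re).csInf_mem hTf
  rw [← hinf, div_lt_iff₀ (hT0 β₁ hβ₁)]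
  constructor
  · intro h α hα β hβ
    calc α.re ≤ sSup (Complex.re '' S) := le_csSup hSf.bddAbove ⟨α, hα, rfl⟩
      _ < t * β₁.re := h
      _ ≤ t * β.re := by
        rw [hinf]
        exact mul_le_mul_of_nonneg_left (csInf_le hTf.bddBelow ⟨β, hβ, rfl⟩) ht.le
  · intro h
    rw [← hsup]
    exact h α₁ hα₁ β₁ hβ₁

/-- The reduced Laplacian block of a cluster is nonsingular iff the cluster has a root, and then its
spectrum lies in the open right half plane. -/
lemma diagBlock_reducedLap_spectrum (N : ℕ) (l : Fin N → ℕ)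
    (b : ((i : Fin N) × Fin (l i)) → ((i : Fin N) × Fin (l i)) → ℝ) (i : Fin N) (hl : 1 ≤ l i)
    (hL : IsLaplacian (Matrix.of fun p q : Fin (l i) => b ⟨i, p⟩ ⟨i, q⟩)) :
    ((∃ r : Fin (l i), ∀ p : Fin (l i),
        Relation.ReflTransGen (fun k j : Fin (l i) => b ⟨i, j⟩ ⟨i, k⟩ < 0) r p) ↔
      (0 : ℂ) ∉ spectrum ℂ ((diagBlock (reducedLap N l b) i).map Complex.ofReal)) ∧
    ((0 : ℂ) ∉ spectrum ℂ ((diagBlock (reducedLap N l b) i).map Complex.ofReal) →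
      ∀ β ∈ spectrum ℂ ((diagBlock (reducedLap N l b) i).map Complex.ofReal), 0 < β.re) := by
  have key : ∀ (s : ℕ) (M : Matrix (Fin s) (Fin s) ℝ) (hs : 1 ≤ s), IsLaplacian M →
      ∀ R : Matrix (Fin (s - 1)) (Fin (s - 1)) ℝ,
      (∀ p q, R p q = M ⟨p.1 + 1, by omega⟩ ⟨q.1 + 1, by omega⟩
        - M ⟨0, by omega⟩ ⟨q.1 + 1, by omega⟩) →
      ((∃ r, ∀ p, Relation.ReflTransGen (fun k j => M j k < 0) r p) ↔
        (0 : ℂ) ∉ spectrum ℂ (R.map Complex.ofReal)) ∧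
      ((0 : ℂ) ∉ spectrum ℂ (R.map Complex.ofReal) →
        ∀ β ∈ spectrum ℂ (R.map Complex.ofReal), 0 < β.re) := by
    intro s M hs hM R hR
    obtain ⟨k, rfl⟩ : ∃ k, s = k + 1 := ⟨s - 1, by omega⟩
    obtain rfl : R = firstRowReduction M := Matrix.ext hR
    change (_ ↔ (0 : ℂ) ∉ spectrum ℂ ((firstRowReduction M).map Complex.ofReal)) ∧
      ((0 : ℂ) ∉ spectrum ℂ ((firstRowReduction M).map Complex.ofReal) →
        ∀ β ∈ spectrum ℂ ((firstRowReduction M).map Complex.ofReal), 0 < β.re)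
    rw [zero_mem_spectrum_map_ofReal_iff]
    exact ⟨⟨hM.det_firstRowReduction_ne_zero, hM.exists_root_of_det_firstRowReduction_ne_zero⟩,
      fun h β hβ => hM.re_pos_of_mem_spectrum_firstRowReduction h hβ⟩
  exact key (l i) _ hl hL _ fun p q => rfl

/-- Corollary 3: under an acyclic partition with nonnegatively weighted subgraphs and
system matrices having at least one eigenvalue with nonnegative real part,
`Â - c L̂_c ⊗ I_n` is Hurwitz if and only if every subgraph contains a directed spanning
tree and `c c_i > max Re σ(A_i) / min Re σ(L̂_{ii})` for every `i`. -/
theorem acyclic_isHurwitz_iff_spanning_tree_and_weights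
    (n N : ℕ) (l : Fin N → ℕ) (hl : ∀ i, 1 ≤ l i) (m : Fin N → ℕ)
    (A : Fin N → Matrix (Fin n) (Fin n) ℝ)
    (B : (i : Fin N) → Matrix (Fin n) (Fin (m i)) ℝ)
    (P : Fin N → Matrix (Fin n) (Fin n) ℝ)
    (hP : ∀ i, (P i).PosDef)
    (hRic : ∀ i, P i * A i + (A i)ᵀ * P i - P i * B i * (B i)ᵀ * P i = -1)
    (K : (i : Fin N) → Matrix (Fin (m i)) (Fin n) ℝ)
    (hK : ∀ i, K i = -((B i)ᵀ * P i))
    -- Assumption 2: each `A_i` has at least one eigenvalue in the closed right half plane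
    (hA : ∀ i : Fin N, ∃ μ ∈ spectrum ℂ ((A i).map Complex.ofReal), 0 ≤ μ.re)
    (a : ((i : Fin N) × Fin (l i)) → ((i : Fin N) × Fin (l i)) → ℝ)
    (ha : ∀ v, a v v = 0)
    (b : ((i : Fin N) × Fin (l i)) → ((i : Fin N) × Fin (l i)) → ℝ)
    (hb : ∀ v w, b v w = if v = w then ∑ u, a v u else -(a v w))
    (hrow : ∀ (i j : Fin N) (p : Fin (l i)), ∑ q : Fin (l j), b ⟨i, p⟩ ⟨j, q⟩ = 0)
    -- the partition is acyclic: no influence from cluster `j` to cluster `i` when `i < j`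
    (hacyclic : ∀ (i j : Fin N), i < j → ∀ (p : Fin (l i)) (q : Fin (l j)),
      b ⟨i, p⟩ ⟨j, q⟩ = 0)
    -- each subgraph is nonnegatively weighted
    (hcoop : ∀ (i : Fin N) (p q : Fin (l i)), 0 ≤ a ⟨i, p⟩ ⟨i, q⟩)
    (c : ℝ) (hc : 0 < c) (ci : Fin N → ℝ) (hci : ∀ i, 0 < ci i) :
    IsHurwitz (clusterMatrix n N l c ci A b) ↔
      ((∀ i : Fin N, ∃ r : Fin (l i), ∀ p : Fin (l i),
          Relation.ReflTransGen (fun k j : Fin (l i) => 0 < a ⟨i, j⟩ ⟨i, k⟩) r p)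
        ∧ ∀ i : Fin N,
            sSup (Complex.re '' spectrum ℂ ((A i).map Complex.ofReal)) /
              sInf (Complex.re '' spectrum ℂ
                ((diagBlock (reducedLap N l b) i).map Complex.ofReal)) <
            c * ci i) := by
  have hoff : ∀ (i : Fin N) (p q : Fin (l i)), p ≠ q → b ⟨i, p⟩ ⟨i, q⟩ = -a ⟨i, p⟩ ⟨i, q⟩ := by
    intro i p q hpq
    rw [hb, if_neg (by simpa using hpq)]
  have hL : ∀ i, IsLaplacian (Matrix.of fun p q : Fin (l i) => b ⟨i, p⟩ ⟨i, q⟩) := fun i =>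
    { offDiag_nonpos := fun p q hpq => by
        rw [Matrix.of_apply, hoff i p q hpq, neg_nonpos]
        exact hcoop i p q
      row_sum := fun p => hrow i i p }
  have hdiag : ∀ (i : Fin N) (p : Fin (l i)), 0 ≤ b ⟨i, p⟩ ⟨i, p⟩ := by
    intro i p
    have h := hrow i i p
    rw [← Finset.add_sum_erase _ _ (Finset.mem_univ p)] at h
    have : ∑ q ∈ Finset.univ.erase p, b ⟨i, p⟩ ⟨i, q⟩ ≤ 0 := Finset.sum_nonpos fun q hq =>
      (hL i).offDiag_nonpos p q (Finset.ne_of_mem_erase hq).symm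
    linarith
  have hedge : ∀ i : Fin N, (fun k j : Fin (l i) => 0 < a ⟨i, j⟩ ⟨i, k⟩) =
      fun k j : Fin (l i) => b ⟨i, j⟩ ⟨i, k⟩ < 0 := by
    intro i
    funext k j
    by_cases hjk : j = k
    · subst hjk
      simp [ha, hdiag i j]
    · rw [hoff i j k hjk, neg_lt_zero]
  have hcci : ∀ i, 0 < c * ci i := fun i => mul_pos hc (hci i)
  have hHurwitz : IsHurwitz (clusterMatrix n N l c ci A b) ↔
      ∀ i, ∀ α ∈ spectrum ℂ ((A i).map Complex.ofReal),
        ∀ β ∈ spectrum ℂ ((diagBlock (reducedLap N l b) i).map Complex.ofReal),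
          α.re < c * ci i * β.re := by
    simp only [IsHurwitz, mem_spectrum_clusterMatrix_iff n N l A b hacyclic c hc ci hci]
    constructor
    · intro h i α hα β hβ
      have := h _ ⟨i, α, hα, β, hβ, rfl⟩
      rwa [Complex.sub_re, Complex.re_ofReal_mul, sub_neg] at this
    · rintro h _ ⟨i, α, hα, β, hβ, rfl⟩
      rw [Complex.sub_re, Complex.re_ofReal_mul, sub_neg]
      exact h i α hα β hβ
  rw [hHurwitz, ← forall_and]
  refine forall_congr' fun i => ?_
  obtain ⟨hroot, hpos⟩ := diagBlock_reducedLap_spectrum N l b i (hl i) (hL i)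
  rw [hedge i, hroot]
  have hiff := fun h0 => sSup_re_div_sInf_re_lt_iff (Matrix.finite_spectrum _)
    (Matrix.finite_spectrum _) ((hA i).imp fun _ h => h.1) (hpos h0) (hcci i)
  constructor
  · intro h
    have h0 : (0 : ℂ) ∉ spectrum ℂ ((diagBlock (reducedLap N l b) i).map Complex.ofReal) := by
      intro hmem
      obtain ⟨α, hα, hre⟩ := hA i
      have := h α hα 0 hmem
      rw [Complex.zero_re, mul_zero] at this
      exact hre.not_gt this
    exact ⟨h0, (hiff h0).2 h⟩
  · rintro ⟨h0, h⟩
    exact (hiff h0).1 h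
end
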